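/- If R[T]/I_C has the WLP, then k[D_σ] = R[T]/J_st has the WLP. -/

import Mathlib

open MvPolynomial

set_option synthInstance.maxHeartbeats 1000000
set_option maxHeartbeats 1000000

noncomputable section

namespace SRWLP

variable (k : Type) [Field k]

/-- An (abstract) simplicial complex on the vertex set `Fin n`:
a collection of finite subsets (faces) closed under passing to subsets. -/
structure SC (n : ℕ) where
  faces : Finset (Finset (Fin n))
  down_closed : ∀ s ∈ faces, ∀ t ⊆ s, t ∈ faces

variable {n : ℕ}

/-- `dimP D = dim D + 1`, i.e. the maximal cardinality of a face of `D`. -/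
def dimP (D : SC n) : ℕ := D.faces.sup Finset.card

/-- The Stanley–Reisner ideal of `D`: the ideal generated by the squarefree
monomials corresponding to non-faces. -/
def srIdeal (D : SC n) : Ideal (MvPolynomial (Fin n) k) :=
  Ideal.span { p | ∃ s : Finset (Fin n), s ∉ D.faces ∧ p = ∏ i ∈ s, X i }

/-- `x_σ`, the product of the variables indexed by the face `σ`. -/
def xFace (σ : Finset (Fin n)) : MvPolynomial (Fin n) k := ∏ i ∈ σ, X i

variable {ι : Type} [Fintype ι]

/-- The degree-`m` graded component of the standard graded algebra
`k[Xᵢ : i ∈ ι] ⧸ J`, as a `k`-submodule. -/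
def qComp (J : Ideal (MvPolynomial ι k)) (m : ℕ) :
    Submodule k (MvPolynomial ι k ⧸ J) :=
  (homogeneousSubmodule ι k m).map (Ideal.Quotient.mkₐ k J).toLinearMap

/-- Graded components indexed by `ℤ` (zero in negative degrees). -/
def qCompZ (J : Ideal (MvPolynomial ι k)) (m : ℤ) :
    Submodule k (MvPolynomial ι k ⧸ J) :=
  if 0 ≤ m then qComp k J m.toNat else ⊥

/-- The Hilbert function of `k[Xᵢ] ⧸ J`. -/
def HFq (J : Ideal (MvPolynomial ι k)) (m : ℕ) : ℕ := Module.finrank k (qComp k J m)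

/-- The Hilbert function, with `ℤ` argument. -/
def HFZ (J : Ideal (MvPolynomial ι k)) (m : ℤ) : ℕ := Module.finrank k (qCompZ k J m)

/-- A property `P` of tuples `c : τ → k` holds *generically* (i.e. for all choices
in a suitable nonempty Zariski-open subset of the affine space `k^τ`) if there is a
nonzero polynomial `g` such that `P c` holds whenever `g` does not vanish at `c`. -/
def Generic (τ : Type) (P : (τ → k) → Prop) : Prop :=
  ∃ g : MvPolynomial τ k, g ≠ 0 ∧ ∀ c : τ → k, eval c g ≠ 0 → P c

/-- The linear form with coefficient tuple `c`. -/
def linForm (c : ι → k) : MvPolynomial ι k := ∑ i, C (c i) * X i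

/-- The ideal `J` together with the `d` linear forms encoded by `c`. -/
def redIdeal (J : Ideal (MvPolynomial ι k)) {d : ℕ} (c : Fin d × ι → k) :
    Ideal (MvPolynomial ι k) :=
  J ⊔ Ideal.span (Set.range fun j : Fin d => linForm k fun i => c (j, i))

/-- `depth (k[Xᵢ]⧸J) ≥ t` : there is a regular sequence of length `t` consisting of
elements of the graded maximal ideal. -/
def depthGE (J : Ideal (MvPolynomial ι k)) (t : ℕ) : Prop :=
  ∃ rs : List (MvPolynomial ι k), rs.length = t ∧
    (∀ f ∈ rs, f ∈ Ideal.span (Set.range (X : ι → MvPolynomial ι k))) ∧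
    RingTheory.Sequence.IsRegular (MvPolynomial ι k ⧸ J)
      (rs.map (Ideal.Quotient.mk J))

/-- `k[Xᵢ]⧸J` is Cohen–Macaulay of Krull dimension `d`. -/
def isCM (J : Ideal (MvPolynomial ι k)) (d : ℕ) : Prop :=
  ringKrullDim (MvPolynomial ι k ⧸ J) = (d : ℕ) ∧ depthGE k J d

/-- The socle of `k[Xᵢ]⧸J` (the annihilator of the graded maximal ideal). -/
def socle (J : Ideal (MvPolynomial ι k)) : Submodule k (MvPolynomial ι k ⧸ J) :=
  ⨅ i : ι, LinearMap.ker (LinearMap.mulLeft k (Ideal.Quotient.mk J (X i)))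

/-- `k[Xᵢ]⧸J` is Artinian Gorenstein: Artinian with one-dimensional socle. -/
def artGor (J : Ideal (MvPolynomial ι k)) : Prop :=
  IsArtinianRing (MvPolynomial ι k ⧸ J) ∧ Module.finrank k (socle k J) = 1

/-- `k[Xᵢ]⧸J` is Gorenstein of Krull dimension `d`: it is Cohen–Macaulay of
dimension `d` and a general Artinian reduction is Artinian Gorenstein. -/
def isGor (J : Ideal (MvPolynomial ι k)) (d : ℕ) : Prop :=
  isCM k J d ∧ Generic k (Fin d × ι) fun c => artGor k (redIdeal k J c)

/-- Multiplication by `ω` from the degree-`m` component to the degree-`(m+1)`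
component of `k[Xᵢ]⧸J` has maximal rank (is injective or surjective). -/
def mulMaxRank (J : Ideal (MvPolynomial ι k)) (ω : MvPolynomial ι k ⧸ J) (m : ℕ) : Prop :=
  (∀ x ∈ qComp k J m, ω * x = 0 → x = 0) ∨
  (∀ y ∈ qComp k J (m + 1), ∃ x ∈ qComp k J m, ω * x = y)

/-- The Weak Lefschetz Property for the Artinian algebra `k[Xᵢ]⧸J`: for a general
linear form `ω`, multiplication `ω : (⧸J)ₘ → (⧸J)ₘ₊₁` has maximal rank for all `m`. -/
def artWLP (J : Ideal (MvPolynomial ι k)) : Prop :=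
  Generic k ι fun c => ∀ m : ℕ,
    mulMaxRank k J (Ideal.Quotient.mk J (linForm k c)) m

/-- The Weak Lefschetz Property for `k[Xᵢ]⧸J` of Krull dimension `d ≥ 1`:
Cohen–Macaulay, and a general Artinian reduction has the WLP. -/
def hasWLP (J : Ideal (MvPolynomial ι k)) (d : ℕ) : Prop :=
  isCM k J d ∧ Generic k (Fin d × ι) fun c => artWLP k (redIdeal k J c)

/-- The Strong Lefschetz Property for the Artinian algebra `k[Xᵢ]⧸J`. -/
def artSLP (J : Ideal (MvPolynomial ι k)) : Prop :=
  ∃ r : ℕ, qComp k J r ≠ ⊥ ∧ (∀ j : ℕ, r < j → qComp k J j = ⊥) ∧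
    (∀ i ≤ r, HFq k J i = HFq k J (r - i)) ∧
    Generic k ι fun c => ∀ i : ℕ, 2 * i ≤ r →
      (∀ x ∈ qComp k J i,
          Ideal.Quotient.mk J (linForm k c) ^ (r - 2 * i) * x = 0 → x = 0) ∧
      (∀ y ∈ qComp k J (r - i), ∃ x ∈ qComp k J i,
          Ideal.Quotient.mk J (linForm k c) ^ (r - 2 * i) * x = y)

/-- The Strong Lefschetz Property for `k[Xᵢ]⧸J` of Krull dimension `d ≥ 1`. -/
def hasSLP (J : Ideal (MvPolynomial ι k)) (d : ℕ) : Prop :=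
  isCM k J d ∧ Generic k (Fin d × ι) fun c => artSLP k (redIdeal k J c)

/-- `D` is Gorenstein* over `k`: every element of the vertex set is a vertex,
`k[D]` is Gorenstein (of dimension `dim D + 1`), and for every vertex `i` there is a
face `τ` with `τ ∪ {i}` not a face. -/
def gorStar (D : SC n) : Prop :=
  (∀ i : Fin n, {i} ∈ D.faces) ∧
  isGor k (srIdeal k D) (dimP D) ∧
  (∀ i : Fin n, ∃ τ ∈ D.faces, insert i τ ∉ D.faces)

/-! `R[T]` is modelled as the polynomial ring in `n+1` variables, the last
variable playing the role of `T`. -/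

/-- The inclusion `R = k[x₁,…,xₙ] → R[T] = k[x₁,…,xₙ,T]`. -/
def toT : MvPolynomial (Fin n) k →ₐ[k] MvPolynomial (Fin (n + 1)) k :=
  rename Fin.castSucc

/-- The variable `T` of `R[T]`. -/
def Tv (n : ℕ) : MvPolynomial (Fin (n + 1)) k := X (Fin.last n)

/-- Extension of an ideal of `R` to `R[T]`. -/
def extI (J : Ideal (MvPolynomial (Fin n) k)) : Ideal (MvPolynomial (Fin (n + 1)) k) :=
  Ideal.map (toT k) J

/-- The ideal `T·J` of `R[T]`, for an ideal `J` of `R`. -/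
def TmulI (J : Ideal (MvPolynomial (Fin n) k)) : Ideal (MvPolynomial (Fin (n + 1)) k) :=
  Ideal.span ((fun f => Tv k n * toT k f) '' (J : Set (MvPolynomial (Fin n) k)))

/-- `I_L = (I_D : x_σ)`, the Stanley–Reisner ideal of the link of `σ` in `D`
(extended to `R`). -/
def linkIdeal (D : SC n) (σ : Finset (Fin n)) : Ideal (MvPolynomial (Fin n) k) :=
  Submodule.colon (srIdeal k D) (Ideal.span {xFace k σ})

/-- `J_st = (I, x_σ, T·I_L) ⊂ R[T]`, the Stanley–Reisner ideal of the stellar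
subdivision `D_σ`. -/
def Jst (D : SC n) (σ : Finset (Fin n)) : Ideal (MvPolynomial (Fin (n + 1)) k) :=
  extI k (srIdeal k D) ⊔ Ideal.span {toT k (xFace k σ)} ⊔ TmulI k (linkIdeal k D σ)

/-- `I_C = (I, T^{q+1}, T·I_L) ⊂ R[T]`. -/
def IC (D : SC n) (σ : Finset (Fin n)) (q : ℕ) : Ideal (MvPolynomial (Fin (n + 1)) k) :=
  extI k (srIdeal k D) ⊔ Ideal.span {Tv k n ^ (q + 1)} ⊔ TmulI k (linkIdeal k D σ)

/-- `I_G = (I, T^{q+1} - x_σ, T·I_L) ⊂ R[T]`. -/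
def IG (D : SC n) (σ : Finset (Fin n)) (q : ℕ) : Ideal (MvPolynomial (Fin (n + 1)) k) :=
  extI k (srIdeal k D) ⊔ Ideal.span {Tv k n ^ (q + 1) - toT k (xFace k σ)} ⊔
    TmulI k (linkIdeal k D σ)

/-- The ideal of `R[T]` generated by `d` general linear forms of `R`
(involving only the `x`-variables). -/
def xForms {d : ℕ} (c : Fin d × Fin n → k) : Ideal (MvPolynomial (Fin (n + 1)) k) :=
  Ideal.span (Set.range fun j : Fin d => toT k (linForm k fun i => c (j, i)))

/-- Property `M_{q,p₁}` for the Artinian algebra `B = R⧸J_B`: for a general linear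
form `ω`, multiplication by `ω^q : B_{p₁-q} → B_{p₁}` is injective. -/
def propM (JB : Ideal (MvPolynomial (Fin n) k)) (q p₁ : ℕ) : Prop :=
  Generic k (Fin n) fun c => ∀ x ∈ qCompZ k JB ((p₁ : ℤ) - (q : ℤ)),
    Ideal.Quotient.mk JB (linForm k c) ^ q * x = 0 → x = 0

section HilbertFunction

variable {k : Type} [Field k] {ι : Type} [Fintype ι]

/-- The ideal contains all homogeneous components of its elements. -/
def IsHomI {k : Type} [Field k] {ι : Type} (J : Ideal (MvPolynomial ι k)) : Prop :=
  ∀ f ∈ J, ∀ m, homogeneousComponent m f ∈ J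

attribute [local instance] MvPolynomial.gradedAlgebra in
lemma isHomI_span {ι : Type} (s : Set (MvPolynomial ι k))
    (h : ∀ f ∈ s, ∃ e, f.IsHomogeneous e) : IsHomI (Ideal.span s) := by
  have : (Ideal.span s).IsHomogeneous (homogeneousSubmodule ι k) :=
    Ideal.homogeneous_span _ s fun f hf => h f hf
  exact fun f hf m => homogeneousComponent_mem_of_mem this hf m

lemma IsHomI.sup {ι : Type} {J K : Ideal (MvPolynomial ι k)} (hJ : IsHomI J) (hK : IsHomI K) :
    IsHomI (J ⊔ K) := by
  intro f hf m
  obtain ⟨a, ha, b, hb, rfl⟩ := Submodule.mem_sup.1 hf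
  rw [map_add]
  exact Submodule.add_mem_sup (hJ a ha m) (hK b hb m)

lemma isHomI_span_singleton {ι : Type} {ℓ : MvPolynomial ι k} {e : ℕ} (h : ℓ.IsHomogeneous e) :
    IsHomI (Ideal.span {ℓ}) :=
  isHomI_span _ (by rintro f rfl; exact ⟨e, h⟩)

lemma finrank_map_add_finrank_inf_ker {V W : Type} [AddCommGroup V] [Module k V]
    [AddCommGroup W] [Module k W] (f : V →ₗ[k] W) (P : Submodule k V) [FiniteDimensional k P] :
    Module.finrank k (P.map f) + Module.finrank k (P ⊓ LinearMap.ker f : Submodule k V)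
      = Module.finrank k P := by
  have h := LinearMap.finrank_range_add_finrank_ker (f.domRestrict P)
  rw [LinearMap.range_domRestrict, LinearMap.ker_domRestrict] at h
  rw [← h, ← Submodule.map_comap_subtype P (LinearMap.ker f)]
  congr 1
  exact (Submodule.equivMapOfInjective P.subtype P.injective_subtype _).finrank_eq.symm

instance finite_homogeneousSubmodule (m : ℕ) :
    FiniteDimensional k (homogeneousSubmodule ι k m) :=
  Module.Finite.iff_fg.2 (homogeneousSubmodule_fg ι k m)

instance finite_qComp (J : Ideal (MvPolynomial ι k)) (m : ℕ) :
    FiniteDimensional k (qComp k J m) :=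
  Module.Finite.iff_fg.2 ((homogeneousSubmodule_fg ι k m).map _)

lemma mem_qComp {ι : Type} {J : Ideal (MvPolynomial ι k)} {m : ℕ} {x : MvPolynomial ι k ⧸ J} :
    x ∈ qComp k J m ↔ ∃ f : MvPolynomial ι k, f.IsHomogeneous m ∧ Ideal.Quotient.mk J f = x :=
  Iff.rfl

lemma mem_ker_mk {ι : Type} {J : Ideal (MvPolynomial ι k)} {f : MvPolynomial ι k} :
    f ∈ LinearMap.ker (Ideal.Quotient.mkₐ k J).toLinearMap ↔ f ∈ J := by
  rw [LinearMap.mem_ker]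
  exact Ideal.Quotient.eq_zero_iff_mem

lemma HFq_add (J : Ideal (MvPolynomial ι k)) (m : ℕ) :
    HFq k J m + Module.finrank k
      (homogeneousSubmodule ι k m ⊓ J.restrictScalars k : Submodule k (MvPolynomial ι k))
      = Module.finrank k (homogeneousSubmodule ι k m) := by
  have h := finrank_map_add_finrank_inf_ker (Ideal.Quotient.mkₐ k J).toLinearMap
    (homogeneousSubmodule ι k m)
  have e : LinearMap.ker (Ideal.Quotient.mkₐ k J).toLinearMap = J.restrictScalars k := by
    ext f; exact mem_ker_mk
  rw [e] at h
  exact h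

lemma HFq_eq_zero {J : Ideal (MvPolynomial ι k)} {m : ℕ} :
    HFq k J m = 0 ↔ ∀ f : MvPolynomial ι k, f.IsHomogeneous m → f ∈ J := by
  rw [HFq, Submodule.finrank_eq_zero, Submodule.eq_bot_iff]
  constructor
  · intro h f hf
    exact Ideal.Quotient.eq_zero_iff_mem.1 (h _ (mem_qComp.2 ⟨f, hf, rfl⟩))
  · rintro h x hx
    obtain ⟨f, hf, rfl⟩ := mem_qComp.1 hx
    exact Ideal.Quotient.eq_zero_iff_mem.2 (h f hf)

lemma ne_top_of_HFq_zero_ne {J : Ideal (MvPolynomial ι k)} (h : HFq k J 0 ≠ 0) : J ≠ ⊤ := by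
  rintro rfl
  exact h (HFq_eq_zero.2 fun _ _ => trivial)

lemma HFq_zero_ne_of_ne_top {J : Ideal (MvPolynomial ι k)} (h : J ≠ ⊤) : HFq k J 0 ≠ 0 :=
  fun h0 => h ((Ideal.eq_top_iff_one J).2 (HFq_eq_zero.1 h0 1 (isHomogeneous_one _ _)))

/-- Hilbert functions do not increase along a homomorphism that is surjective in the given degree
and maps the first ideal into the second one. -/
lemma HFq_le_of_map {κ : Type} [Fintype κ] {J : Ideal (MvPolynomial ι k)}
    {K : Ideal (MvPolynomial κ k)} (ψ : MvPolynomial ι k →ₐ[k] MvPolynomial κ k)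
    (hψ : J ≤ K.comap ψ) (m : ℕ)
    (hs : ∀ g : MvPolynomial κ k, g.IsHomogeneous m → ∃ f, f.IsHomogeneous m ∧ ψ f = g) :
    HFq k K m ≤ HFq k J m := by
  let π := Ideal.quotientMapₐ K ψ hψ
  have hle : qComp k K m ≤ (qComp k J m).map π.toLinearMap := by
    intro x hx
    obtain ⟨g, hg, rfl⟩ := mem_qComp.1 hx
    obtain ⟨f, hf, rfl⟩ := hs g hg
    exact ⟨Ideal.Quotient.mk J f, mem_qComp.2 ⟨f, hf, rfl⟩, rfl⟩
  exact (Submodule.finrank_mono hle).trans (Submodule.finrank_map_le _ _)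

lemma HFq_anti {J K : Ideal (MvPolynomial ι k)} (h : J ≤ K) (m : ℕ) :
    HFq k K m ≤ HFq k J m :=
  HFq_le_of_map (AlgHom.id k _) h m fun g hg => ⟨g, hg, rfl⟩

lemma homogeneousComponent_mul_linear {ι : Type} {ℓ : MvPolynomial ι k} (hℓ : ℓ.IsHomogeneous 1)
    (f : MvPolynomial ι k) (m : ℕ) :
    homogeneousComponent (m + 1) (f * ℓ) = homogeneousComponent m f * ℓ := by
  conv_lhs => rw [← sum_homogeneousComponent f, Finset.sum_mul, map_sum]
  rw [Finset.sum_congr rfl fun i _ => homogeneousComponent_of_mem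
    (((homogeneousComponent_isHomogeneous i f).mul hℓ))]
  simp only [add_left_inj]
  rw [Finset.sum_ite_eq]
  split_ifs with h
  · rfl
  · rw [homogeneousComponent_eq_zero, zero_mul]
    simpa using h

/-- Relation of the Hilbert function of a quotient by a linear form to the rank of multiplication
by that form. -/
lemma exists_rank_mul_linear {J : Ideal (MvPolynomial ι k)} (hJ : IsHomI J)
    {ℓ : MvPolynomial ι k} (hℓ : ℓ.IsHomogeneous 1) (m : ℕ) :
    ∃ r t : ℕ, HFq k (J ⊔ Ideal.span {ℓ}) (m + 1) + r = HFq k J (m + 1) ∧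
      r + t = HFq k J m ∧
      (t = 0 ↔ ∀ x ∈ qComp k J m, Ideal.Quotient.mk J ℓ * x = 0 → x = 0) ∧
      (HFq k (J ⊔ Ideal.span {ℓ}) (m + 1) = 0 ↔
        ∀ y ∈ qComp k J (m + 1), ∃ x ∈ qComp k J m, Ideal.Quotient.mk J ℓ * x = y) := by
  set ω := Ideal.Quotient.mk J ℓ with hω
  let M := LinearMap.mulLeft k ω
  let Q := (qComp k J m).map M
  let π := (Ideal.Quotient.factorₐ k (le_sup_left : J ≤ J ⊔ Ideal.span {ℓ})).toLinearMap
  have h1 := finrank_map_add_finrank_inf_ker M (qComp k J m)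
  have h2 := finrank_map_add_finrank_inf_ker π (qComp k J (m + 1))
  have hmap : (qComp k J (m + 1)).map π = qComp k (J ⊔ Ideal.span {ℓ}) (m + 1) := by
    ext x
    constructor
    · rintro ⟨_, ⟨f, hf, rfl⟩, rfl⟩
      exact ⟨f, hf, rfl⟩
    · rintro ⟨f, hf, rfl⟩
      exact ⟨_, ⟨f, hf, rfl⟩, rfl⟩
  have hker : qComp k J (m + 1) ⊓ LinearMap.ker π = Q := by
    ext x
    constructor
    · rintro ⟨hx, hx0⟩
      obtain ⟨f, hf, rfl⟩ := mem_qComp.1 hx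
      have hf' : f ∈ J ⊔ Ideal.span {ℓ} := Ideal.Quotient.eq_zero_iff_mem.1 hx0
      obtain ⟨a, ha, b, hb, rfl⟩ := Submodule.mem_sup.1 hf'
      obtain ⟨g, rfl⟩ := Ideal.mem_span_singleton'.1 hb
      refine ⟨Ideal.Quotient.mk J (homogeneousComponent m g),
        mem_qComp.2 ⟨_, homogeneousComponent_isHomogeneous _ _, rfl⟩, ?_⟩
      have h := homogeneousComponent_eq_self hf
      rw [map_add, homogeneousComponent_mul_linear hℓ] at h
      rw [← h]
      change ω * _ = _
      rw [map_add, Ideal.Quotient.eq_zero_iff_mem.2 (hJ a ha (m + 1)), zero_add, map_mul, mul_comm]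
    · rintro ⟨_, ⟨f, hf, rfl⟩, rfl⟩
      refine ⟨mem_qComp.2 ⟨f * ℓ, hf.mul hℓ, ?_⟩, ?_⟩
      · rw [map_mul, mul_comm]; rfl
      · change Ideal.Quotient.mk _ (ℓ * f) = 0
        exact Ideal.Quotient.eq_zero_iff_mem.2
          (Ideal.mul_mem_right _ _ (Ideal.mem_sup_right (Ideal.mem_span_singleton_self ℓ)))
  have hQ : Q ≤ qComp k J (m + 1) := hker ▸ inf_le_left
  rw [hmap, hker] at h2
  refine ⟨Module.finrank k Q, _, h2, h1, ?_, ?_⟩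
  · rw [Submodule.finrank_eq_zero, Submodule.eq_bot_iff]
    exact ⟨fun h x hx h0 => h x ⟨hx, h0⟩, fun h x hx => h x hx.1 hx.2⟩
  · have h3 : HFq k (J ⊔ Ideal.span {ℓ}) (m + 1) = 0 ↔
        Module.finrank k Q = Module.finrank k (qComp k J (m + 1)) := by
      unfold HFq; omega
    rw [h3]
    constructor
    · intro h y hy
      rw [← Submodule.eq_of_le_of_finrank_eq hQ h] at hy
      exact hy
    · intro h
      rw [le_antisymm hQ fun y hy => h y hy]

lemma HFq_succ_le {J : Ideal (MvPolynomial ι k)} (hJ : IsHomI J)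
    {ℓ : MvPolynomial ι k} (hℓ : ℓ.IsHomogeneous 1) (m : ℕ) :
    HFq k J (m + 1) ≤ HFq k J m + HFq k (J ⊔ Ideal.span {ℓ}) (m + 1) := by
  obtain ⟨r, t, h1, h2, -, -⟩ := exists_rank_mul_linear hJ hℓ m
  omega

lemma mulMaxRank_iff {J : Ideal (MvPolynomial ι k)} (hJ : IsHomI J)
    {ℓ : MvPolynomial ι k} (hℓ : ℓ.IsHomogeneous 1) (m : ℕ) :
    mulMaxRank k J (Ideal.Quotient.mk J ℓ) m ↔
      HFq k (J ⊔ Ideal.span {ℓ}) (m + 1) ≤ HFq k J (m + 1) - HFq k J m := by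
  obtain ⟨r, t, h1, h2, h3, h4⟩ := exists_rank_mul_linear hJ hℓ m
  rw [mulMaxRank, ← h3, ← h4]
  omega

lemma HFq_succ_eq_iff {J : Ideal (MvPolynomial ι k)} (hJ : IsHomI J)
    {ℓ : MvPolynomial ι k} (hℓ : ℓ.IsHomogeneous 1) (m : ℕ) :
    HFq k J (m + 1) = HFq k J m + HFq k (J ⊔ Ideal.span {ℓ}) (m + 1) ↔
      ∀ f : MvPolynomial ι k, f.IsHomogeneous m → ℓ * f ∈ J → f ∈ J := by
  obtain ⟨r, t, h1, h2, h3, -⟩ := exists_rank_mul_linear hJ hℓ m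
  have : HFq k J (m + 1) = HFq k J m + HFq k (J ⊔ Ideal.span {ℓ}) (m + 1) ↔ t = 0 := by omega
  rw [this, h3]
  constructor
  · intro h f hf hl
    refine Ideal.Quotient.eq_zero_iff_mem.1 (h _ (mem_qComp.2 ⟨f, hf, rfl⟩) ?_)
    rw [← map_mul]
    exact Ideal.Quotient.eq_zero_iff_mem.2 hl
  · intro h x hx h0
    obtain ⟨f, hf, rfl⟩ := mem_qComp.1 hx
    rw [← map_mul] at h0
    exact Ideal.Quotient.eq_zero_iff_mem.2 (h f hf (Ideal.Quotient.eq_zero_iff_mem.1 h0))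

lemma HFq_sup_linear_zero {J : Ideal (MvPolynomial ι k)} (hJ : IsHomI J)
    {ℓ : MvPolynomial ι k} (hℓ : ℓ.IsHomogeneous 1) :
    HFq k (J ⊔ Ideal.span {ℓ}) 0 = HFq k J 0 := by
  have e : (homogeneousSubmodule ι k 0 ⊓ (J ⊔ Ideal.span {ℓ}).restrictScalars k :
      Submodule k (MvPolynomial ι k)) = homogeneousSubmodule ι k 0 ⊓ J.restrictScalars k := by
    ext f
    refine ⟨fun hf => ⟨hf.1, ?_⟩, fun hf => ⟨hf.1, Ideal.mem_sup_left hf.2⟩⟩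
    obtain ⟨a, ha, b, hb, rfl⟩ := Submodule.mem_sup.1 hf.2
    obtain ⟨g, rfl⟩ := Ideal.mem_span_singleton'.1 hb
    have h := homogeneousComponent_eq_self hf.1
    rw [map_add] at h
    have h0 : homogeneousComponent 0 (g * ℓ) = 0 := by
      rw [homogeneousComponent_zero, ← constantCoeff_eq, map_mul, constantCoeff_eq,
        show coeff 0 ℓ = 0 from hℓ.coeff_eq_zero (by simp), mul_zero, C_0]
    rw [h0, add_zero] at h
    have := hJ a ha 0
    rw [h] at this
    exact this
  have h1 := HFq_add J 0
  have h2 := HFq_add (J ⊔ Ideal.span {ℓ}) 0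
  rw [e] at h2
  omega

end HilbertFunction

section Semicontinuity

variable {k : Type} [Field k] {ι τ : Type}

/-- `P` holds on a principal open neighbourhood of `x₀` in the affine space `k^τ`. -/
def OpenAt (x₀ : τ → k) (P : (τ → k) → Prop) : Prop :=
  ∃ g : MvPolynomial τ k, eval x₀ g ≠ 0 ∧ ∀ x, eval x g ≠ 0 → P x

lemma OpenAt.and {x₀ : τ → k} {P Q : (τ → k) → Prop} (hP : OpenAt x₀ P) (hQ : OpenAt x₀ Q) :
    OpenAt x₀ fun x => P x ∧ Q x := by
  obtain ⟨g, hg, hP⟩ := hP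
  obtain ⟨h, hh, hQ⟩ := hQ
  refine ⟨g * h, by rw [map_mul]; exact mul_ne_zero hg hh, fun x hx => ?_⟩
  rw [map_mul] at hx
  exact ⟨hP x (left_ne_zero_of_mul hx), hQ x (right_ne_zero_of_mul hx)⟩

lemma OpenAt.forall_lt {x₀ : τ → k} {P : ℕ → (τ → k) → Prop} (h : ∀ m, OpenAt x₀ (P m)) (N : ℕ) :
    OpenAt x₀ fun x => ∀ m < N, P m x := by
  induction N with
  | zero => exact ⟨1, by simp, fun x _ m hm => absurd hm (Nat.not_lt_zero m)⟩
  | succ N ih =>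
    obtain ⟨g, hg, H⟩ := ih.and (h N)
    refine ⟨g, hg, fun x hx m hm => ?_⟩
    rcases Nat.lt_succ_iff_lt_or_eq.1 hm with hm | rfl
    · exact (H x hx).1 m hm
    · exact (H x hx).2

/-- A family of homogeneous ideals whose generators depend polynomially on parameters. -/
def PolyFamily (J : (τ → k) → Ideal (MvPolynomial ι k)) : Prop :=
  ∃ (κ : Type) (F : κ → MvPolynomial ι (MvPolynomial τ k)) (e : κ → ℕ),
    (∀ i, (F i).IsHomogeneous (e i)) ∧
    ∀ x, J x = Ideal.span (Set.range fun i => map (eval x) (F i))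

lemma PolyFamily.sup {J K : (τ → k) → Ideal (MvPolynomial ι k)} (hJ : PolyFamily J)
    (hK : PolyFamily K) : PolyFamily fun x => J x ⊔ K x := by
  obtain ⟨κ, F, e, hF, hJ⟩ := hJ
  obtain ⟨κ', F', e', hF', hK⟩ := hK
  refine ⟨κ ⊕ κ', Sum.elim F F', Sum.elim e e', ?_, fun x => ?_⟩
  · rintro (i | i)
    · exact hF i
    · exact hF' i
  · beta_reduce
    rw [hJ, hK, ← Ideal.span_union]
    congr 1
    ext f
    simp

lemma polyFamily_const {J : Ideal (MvPolynomial ι k)} (hJ : IsHomI J) :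
    PolyFamily fun _ : τ → k => J := by
  refine ⟨{p : MvPolynomial ι k × ℕ // p.1 ∈ J ∧ p.1.IsHomogeneous p.2},
    fun p => map C p.1.1, fun p => p.1.2, fun p => p.2.2.map C, fun x => ?_⟩
  have : ∀ f : MvPolynomial ι k, map (eval x) (map C f) = f := by
    intro f
    rw [map_map]
    have : (eval x).comp (C : k →+* MvPolynomial τ k) = RingHom.id k := by ext; simp
    rw [this, map_id]
  simp only [this]
  apply le_antisymm
  · intro f hf
    rw [← sum_homogeneousComponent f]
    exact Ideal.sum_mem _ fun i _ => Ideal.subset_span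
      ⟨⟨(_, i), hJ f hf i, homogeneousComponent_isHomogeneous i f⟩, rfl⟩
  · rw [Ideal.span_le]
    rintro _ ⟨p, rfl⟩
    exact p.2.1

lemma PolyFamily.isHomI {J : (τ → k) → Ideal (MvPolynomial ι k)} (hJ : PolyFamily J) (x : τ → k) :
    IsHomI (J x) := by
  obtain ⟨κ, F, e, hF, hJ⟩ := hJ
  rw [hJ]
  refine isHomI_span _ ?_
  rintro _ ⟨i, rfl⟩
  exact ⟨e i, (hF i).map _⟩

/-- A homogeneous element of the ideal generated by homogeneous elements is a `k`-linear
combination of monomial multiples of the generators in the same degree. -/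
lemma mem_span_monomial_mul {κ : Type} (F : κ → MvPolynomial ι k) (e : κ → ℕ)
    (hF : ∀ i, (F i).IsHomogeneous (e i)) (m : ℕ) {f : MvPolynomial ι k}
    (hf : f ∈ Ideal.span (Set.range F)) :
    homogeneousComponent m f ∈ Submodule.span k
      (Set.range fun p : {p : κ × (ι →₀ ℕ) // p.2.degree + e p.1 = m} =>
        monomial p.1.2 (1 : k) * F p.1.1) := by
  set W := Submodule.span k
      (Set.range fun p : {p : κ × (ι →₀ ℕ) // p.2.degree + e p.1 = m} =>
        monomial p.1.2 (1 : k) * F p.1.1) with hW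
  have key : ∀ a : MvPolynomial ι k, homogeneousComponent m (a * f) ∈ W := by
    induction hf using Submodule.span_induction with
    | mem f hf =>
      obtain ⟨i, rfl⟩ := hf
      intro a
      induction a using MvPolynomial.induction_on' with
      | monomial u c =>
        rw [homogeneousComponent_of_mem ((isHomogeneous_monomial c rfl).mul (hF i))]
        split_ifs with h
        · have : monomial u c * F i = c • (monomial u (1 : k) * F i) := by
            rw [← smul_mul_assoc, smul_monomial, smul_eq_mul, mul_one]
          rw [this]
          exact W.smul_mem c (Submodule.subset_span ⟨⟨(i, u), h.symm⟩, rfl⟩)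
        · exact W.zero_mem
      | add p q hp hq =>
        rw [add_mul, map_add]
        exact W.add_mem hp hq
    | zero => intro a; simp
    | add f g _ _ hf hg =>
      intro a
      rw [mul_add, map_add]
      exact W.add_mem (hf a) (hg a)
    | smul b f _ hf =>
      intro a
      rw [smul_eq_mul, ← mul_assoc]
      exact hf _
  simpa using key 1

/-- Linear functionals extend to polynomials with polynomial coefficients compatibly with
specialization. -/
lemma exists_polynomial_functional (L : MvPolynomial ι k →ₗ[k] k)
    (G : MvPolynomial ι (MvPolynomial τ k)) :
    ∃ g : MvPolynomial τ k, ∀ x, eval x g = L (map (eval x) G) := by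
  induction G using MvPolynomial.induction_on' with
  | monomial u c =>
    refine ⟨c * C (L (monomial u 1)), fun x => ?_⟩
    rw [map_mul, eval_C, map_monomial, ← smul_eq_mul, ← map_smul, smul_monomial, smul_eq_mul,
      mul_one]
  | add p q hp hq =>
    obtain ⟨g, hg⟩ := hp
    obtain ⟨h, hh⟩ := hq
    exact ⟨g + h, fun x => by rw [map_add, map_add, map_add, hg, hh]⟩

/-- Linear independence is an open condition. -/
lemma openAt_linearIndependent {β : Type} [Finite β] (V : β → MvPolynomial ι (MvPolynomial τ k))
    (x₀ : τ → k) (h : LinearIndependent k fun b => map (eval x₀) (V b)) :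
    OpenAt x₀ fun x => LinearIndependent k fun b => map (eval x) (V b) := by
  classical
  cases nonempty_fintype β
  obtain ⟨L, hL⟩ := LinearMap.exists_leftInverse_of_injective
    (Finsupp.linearCombination k fun b => map (eval x₀) (V b))
    (LinearMap.ker_eq_bot.2 h)
  choose g hg using fun b b' => exists_polynomial_functional (τ := τ)
    ((Finsupp.lapply b : (β →₀ k) →ₗ[k] k) ∘ₗ L) (V b')
  have hdet : ∀ x, eval x (Matrix.det (Matrix.of g)) =
      Matrix.det (Matrix.of fun b b' => L (map (eval x) (V b')) b) := by
    intro x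
    rw [RingHom.map_det]
    congr 1
    ext b b'
    exact hg b b' x
  refine ⟨Matrix.det (Matrix.of g), ?_, fun x hx => ?_⟩
  · rw [hdet]
    have : (Matrix.of fun b b' => L (map (eval x₀) (V b')) b) = (1 : Matrix β β k) := by
      ext b b'
      have := LinearMap.congr_fun hL (Finsupp.single b' 1)
      rw [LinearMap.comp_apply, Finsupp.linearCombination_single, one_smul] at this
      rw [Matrix.of_apply, this, LinearMap.id_apply, Finsupp.single_apply, Matrix.one_apply]
      simp only [eq_comm]
    rw [this, Matrix.det_one]
    exact one_ne_zero
  · rw [hdet] at hx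
    rw [Fintype.linearIndependent_iff]
    intro a ha
    have hmul : Matrix.mulVec (Matrix.of fun b b' => L (map (eval x) (V b')) b) a = 0 := by
      ext b
      have := congrArg (fun f => L f b) ha
      simp only [map_sum, map_smul, Finsupp.coe_finsetSum, Finset.sum_apply, map_zero,
        Finsupp.coe_zero, Pi.zero_apply, Finsupp.smul_apply, smul_eq_mul] at this
      rw [Matrix.mulVec, dotProduct, Pi.zero_apply, ← this]
      exact Finset.sum_congr rfl fun i _ => mul_comm _ _
    exact congrFun (Matrix.eq_zero_of_mulVec_eq_zero hx hmul)

/-- Upper semicontinuity of Hilbert functions. -/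
lemma PolyFamily.openAt_HFq_le [Fintype ι] {J : (τ → k) → Ideal (MvPolynomial ι k)}
    (hJ : PolyFamily J) (x₀ : τ → k) (m : ℕ) :
    OpenAt x₀ fun x => HFq k (J x) m ≤ HFq k (J x₀) m := by
  obtain ⟨κ, F, e, hF, hJ⟩ := hJ
  let I := {p : κ × (ι →₀ ℕ) // p.2.degree + e p.1 = m}
  let V : I → MvPolynomial ι (MvPolynomial τ k) := fun p => monomial p.1.2 1 * F p.1.1
  have hV : ∀ x p, map (eval x) (V p) = monomial p.1.2 1 * map (eval x) (F p.1.1) := by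
    intro x p
    rw [map_mul, map_monomial, map_one]
  let P : (τ → k) → Submodule k (MvPolynomial ι k) :=
    fun x => homogeneousSubmodule ι k m ⊓ (J x).restrictScalars k
  have hfin : ∀ x, FiniteDimensional k (P x) := fun x =>
    Submodule.finiteDimensional_of_le (inf_le_left : P x ≤ homogeneousSubmodule ι k m)
  have hVP : ∀ x p, map (eval x) (V p) ∈ P x := by
    intro x p
    rw [hV]
    refine ⟨?_, ?_⟩
    · have := (isHomogeneous_monomial (1 : k) (rfl : p.1.2.degree = _)).mul
        ((hF p.1.1).map (eval x))
      rw [p.2] at this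
      exact this
    · rw [hJ]
      exact Ideal.mul_mem_left _ _ (Ideal.subset_span ⟨p.1.1, rfl⟩)
  have hspan : P x₀ ≤ Submodule.span k (Set.range fun p => map (eval x₀) (V p)) := by
    intro f hf
    have h2 : f ∈ J x₀ := hf.2
    rw [hJ] at h2
    have := mem_span_monomial_mul _ e (fun i => (hF i).map (eval x₀)) m h2
    rw [homogeneousComponent_eq_self hf.1] at this
    simpa only [hV] using this
  obtain ⟨b, hbsub, hbspan, hbli⟩ := exists_linearIndependent k
    (Set.range fun p => map (eval x₀) (V p))
  have hbP : ∀ v : b, (v : MvPolynomial ι k) ∈ P x₀ := by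
    intro v
    obtain ⟨p, hp⟩ := hbsub v.2
    rw [← hp]
    exact hVP x₀ p
  have hbP' : LinearIndependent k fun v : b => (⟨v, hbP v⟩ : P x₀) :=
    LinearIndependent.of_comp (P x₀).subtype hbli
  have := hbP'.finite
  cases nonempty_fintype b
  choose s hs using fun v : b => hbsub v.2
  have hli : LinearIndependent k fun v : b => map (eval x₀) (V (s v)) := by
    simpa only [hs] using hbli
  obtain ⟨g, hg, H⟩ := openAt_linearIndependent (fun v => V (s v)) x₀ hli
  refine ⟨g, hg, fun x hx => ?_⟩
  have hx' : LinearIndependent k fun v : b => (⟨_, hVP x (s v)⟩ : P x) :=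
    LinearIndependent.of_comp (P x).subtype (H x hx)
  have h1 : Fintype.card b ≤ Module.finrank k (P x) := hx'.fintype_card_le_finrank
  have h2 : Module.finrank k (P x₀) ≤ Fintype.card b := by
    rw [← hbspan] at hspan
    have : FiniteDimensional k (Submodule.span k b) :=
      FiniteDimensional.span_of_finite k (Set.toFinite b)
    refine (Submodule.finrank_mono hspan).trans ?_
    have := finrank_span_le_card (R := k) b
    rwa [Set.toFinset_card] at this
  have h3 := HFq_add (J x) m
  have h4 := HFq_add (J x₀) m
  change _ + Module.finrank k (P x) = _ at h3
  change _ + Module.finrank k (P x₀) = _ at h4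
  omega

end Semicontinuity

section RegularSequences

/-- `r` is a nonzerodivisor modulo `J`. -/
def RegMod {A : Type} [CommRing A] (J : Ideal A) (r : A) : Prop := ∀ f, r * f ∈ J → f ∈ J

/-- The list `rs` is a weakly regular sequence on `A ⧸ J`. -/
def RegSeq {A : Type} [CommRing A] (rs : List A) (J : Ideal A) : Prop :=
  ∀ (i : ℕ) (h : i < rs.length), RegMod (J ⊔ Ideal.ofList (rs.take i)) rs[i]

lemma regSeq_nil {A : Type} [CommRing A] (J : Ideal A) : RegSeq [] J :=
  fun i h => absurd h (Nat.not_lt_zero i)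

lemma regSeq_cons {A : Type} [CommRing A] {r : A} {rs : List A} {J : Ideal A} :
    RegSeq (r :: rs) J ↔ RegMod J r ∧ RegSeq rs (J ⊔ Ideal.span {r}) := by
  constructor
  · intro h
    refine ⟨by simpa using h 0 (Nat.succ_pos _), fun i hi => ?_⟩
    have := h (i + 1) (Nat.succ_lt_succ hi)
    rwa [List.take_succ_cons, Ideal.ofList_cons, ← sup_assoc] at this
  · rintro ⟨h0, h⟩ i hi
    cases i with
    | zero => simpa using h0
    | succ i =>
      rw [List.take_succ_cons, Ideal.ofList_cons, ← sup_assoc]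
      exact h i (Nat.lt_of_succ_lt_succ hi)

lemma mk_mem_smul_top {A : Type} [CommRing A] {J K : Ideal A} {f : A} :
    Ideal.Quotient.mk J f ∈ (K • ⊤ : Submodule A (A ⧸ J)) ↔ f ∈ J ⊔ K := by
  have h : (K • ⊤ : Submodule A (A ⧸ J)) =
      Submodule.map (Submodule.mkQ J) (K : Submodule A A) := by
    have := Submodule.map_smul'' K (⊤ : Submodule A A) (Submodule.mkQ J)
    rw [Submodule.map_top, Submodule.range_mkQ, Ideal.smul_eq_mul, Ideal.mul_top] at this
    exact this.symm
  rw [h]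
  change (Submodule.mkQ J f) ∈ _ ↔ _
  rw [← Submodule.mem_comap, Submodule.comap_map_mkQ]

lemma isWeaklyRegular_iff_regSeq {A : Type} [CommRing A] {rs : List A} {J : Ideal A} :
    RingTheory.Sequence.IsWeaklyRegular (A ⧸ J) (rs.map (Ideal.Quotient.mk J)) ↔ RegSeq rs J := by
  rw [← Ideal.Quotient.algebraMap_eq, RingTheory.Sequence.isWeaklyRegular_map_algebraMap_iff,
    RingTheory.Sequence.isWeaklyRegular_iff]
  refine forall₂_congr fun i h => ?_
  rw [isSMulRegular_quotient_iff_mem_of_smul_mem, RegMod,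
    (Ideal.Quotient.mk_surjective (I := J)).forall]
  refine forall_congr' fun f => ?_
  rw [Algebra.smul_def, Ideal.Quotient.algebraMap_eq, ← map_mul, mk_mem_smul_top, mk_mem_smul_top]

lemma isRegular_of_regSeq {A : Type} [CommRing A] {rs : List A} {J : Ideal A} (h : RegSeq rs J)
    (hne : J ⊔ Ideal.ofList rs ≠ ⊤) :
    RingTheory.Sequence.IsRegular (A ⧸ J) (rs.map (Ideal.Quotient.mk J)) := by
  refine ⟨isWeaklyRegular_iff_regSeq.2 h, fun he => hne ?_⟩
  rw [Ideal.smul_eq_mul, Ideal.mul_top, ← Ideal.map_ofList] at he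
  have := congrArg (Ideal.comap (Ideal.Quotient.mk J)) he
  rw [Ideal.comap_top, Ideal.comap_map_of_surjective' _ Ideal.Quotient.mk_surjective,
    Ideal.mk_ker, sup_comm] at this
  exact this.symm

lemma ringKrullDim_add_length_le {A : Type} [CommRing A] {rs : List A} {J : Ideal A}
    (h : RegSeq rs J) :
    ringKrullDim (A ⧸ (J ⊔ Ideal.ofList rs)) + (rs.length : ℕ) ≤ ringKrullDim (A ⧸ J) := by
  induction rs generalizing J with
  | nil =>
    rw [Ideal.ofList_nil, sup_bot_eq]
    simp
  | cons r rs ih =>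
    obtain ⟨h0, h1⟩ := regSeq_cons.1 h
    have h2 := ih h1
    have h3 : ringKrullDim (A ⧸ (J ⊔ Ideal.span {r})) + 1 ≤ ringKrullDim (A ⧸ J) := by
      refine ringKrullDim_succ_le_of_surjective (Ideal.Quotient.factor le_sup_left)
        (Ideal.Quotient.factor_surjective _) (r := Ideal.Quotient.mk J r) ?_ ?_
      · rw [mem_nonZeroDivisors_iff_right]
        intro x hx
        obtain ⟨f, rfl⟩ := Ideal.Quotient.mk_surjective x
        rw [← map_mul, Ideal.Quotient.eq_zero_iff_mem, mul_comm] at hx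
        exact Ideal.Quotient.eq_zero_iff_mem.2 (h0 f hx)
      · exact Ideal.Quotient.eq_zero_iff_mem.2
          (Ideal.mem_sup_right (Ideal.mem_span_singleton_self r))
    rw [Ideal.ofList_cons, ← sup_assoc, List.length_cons, Nat.cast_add, Nat.cast_one, ← add_assoc]
    exact (add_le_add_left h2 1).trans h3

/-- A regular sequence on `A ⧸ J` stays regular modulo an element that is a nonzerodivisor modulo
all initial parts of the sequence. -/
lemma regSeq_sup_of_regMod {A : Type} [CommRing A] {xs : List A} {J : Ideal A} {z : A}
    (h : RegSeq xs J) (hz : ∀ i ≤ xs.length, RegMod (J ⊔ Ideal.ofList (xs.take i)) z) :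
    RegSeq xs (J ⊔ Ideal.span {z}) := by
  induction xs generalizing J with
  | nil => exact regSeq_nil _
  | cons x xs ih =>
    obtain ⟨h0, h1⟩ := regSeq_cons.1 h
    refine regSeq_cons.2 ⟨?_, ?_⟩
    · intro m hm
      obtain ⟨j, hj, b, hb, hjb⟩ := Submodule.mem_sup.1 hm
      obtain ⟨m', rfl⟩ := Ideal.mem_span_singleton'.1 hb
      have hz1 : RegMod (J ⊔ Ideal.span {x}) z := by
        have := hz 1 (by simp)
        simpa [Ideal.ofList_singleton] using this
      have hm' : m' ∈ J ⊔ Ideal.span {x} := by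
        refine hz1 m' ?_
        have : z * m' = x * m + -j := by rw [← hjb]; ring
        rw [this, add_comm]
        exact Submodule.add_mem_sup (J.neg_mem hj)
          (Ideal.mul_mem_right _ _ (Ideal.mem_span_singleton_self x))
      obtain ⟨j', hj', b', hb', rfl⟩ := Submodule.mem_sup.1 hm'
      obtain ⟨m'', rfl⟩ := Ideal.mem_span_singleton'.1 hb'
      have : m - z * m'' ∈ J := by
        refine h0 _ ?_
        have : x * (m - z * m'') = j + z * j' := by
          rw [mul_sub, ← hjb]; ring
        rw [this]
        exact J.add_mem hj (J.mul_mem_left _ hj')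
      rw [← sub_add_cancel m (z * m'')]
      exact Submodule.add_mem_sup this
        (Ideal.mul_mem_right _ _ (Ideal.mem_span_singleton_self z))
    · rw [sup_right_comm]
      refine ih h1 fun i hi => ?_
      have := hz (i + 1) (Nat.succ_le_succ hi)
      rwa [List.take_succ_cons, Ideal.ofList_cons, ← sup_assoc] at this

end RegularSequences

section LinearRegularSequences

variable {k : Type} [Field k] {ι : Type} [Fintype ι]

lemma linForm_single [DecidableEq ι] (i : ι) : linForm k (Pi.single i 1) = X i := by
  rw [linForm, Finset.sum_eq_single i]
  · simp
  · intro j _ hj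
    simp [Pi.single_eq_of_ne hj]
  · simp

lemma linForm_isHomogeneous (c : ι → k) : (linForm k c).IsHomogeneous 1 :=
  IsHomogeneous.sum _ _ _ fun i _ => by
    simpa using (isHomogeneous_C ι (c i)).mul (isHomogeneous_X k i)

lemma linForm_mem_span (c : ι → k) :
    linForm k c ∈ Ideal.span (Set.range (X : ι → MvPolynomial ι k)) :=
  Ideal.sum_mem _ fun i _ => Ideal.mul_mem_left _ _ (Ideal.subset_span ⟨i, rfl⟩)

/-- Over an infinite field there is a linear form that is simultaneously regular modulo finitely
many ideals, provided the irrelevant ideal contains a regular element modulo each. -/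
lemma exists_linForm_regMod [Infinite k] {β : Type} [Finite β]
    (K : β → Ideal (MvPolynomial ι k))
    (hK : ∀ b, ∃ x ∈ Ideal.span (Set.range (X : ι → MvPolynomial ι k)), RegMod (K b) x) :
    ∃ c : ι → k, ∀ b, RegMod (K b) (linForm k c) := by
  classical
  have hreg : ∀ (b : β) (x : MvPolynomial ι k), RegMod (K b) x ↔
      ∀ p ∈ associatedPrimes (MvPolynomial ι k) (MvPolynomial ι k ⧸ K b), x ∉ p := by
    intro b x
    have h := biUnion_associatedPrimes_eq_compl_regular (MvPolynomial ι k) (MvPolynomial ι k ⧸ K b)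
    have h1 : IsSMulRegular (MvPolynomial ι k ⧸ K b) x ↔ RegMod (K b) x :=
      isSMulRegular_quotient_iff_mem_of_smul_mem (K b) x
    rw [← h1]
    have h2 : x ∈ ⋃ p ∈ associatedPrimes (MvPolynomial ι k) (MvPolynomial ι k ⧸ K b),
        (p : Set (MvPolynomial ι k)) ↔ ¬ IsSMulRegular (MvPolynomial ι k ⧸ K b) x := by
      rw [h]; rfl
    rw [← not_iff_not, ← h2]
    simp
  let lin : (ι → k) →ₗ[k] MvPolynomial ι k :=
    { toFun := linForm k
      map_add' := fun a b => by
        simp only [linForm, Pi.add_apply, map_add, add_mul, Finset.sum_add_distrib]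
      map_smul' := fun a b => by
        simp only [linForm, Pi.smul_apply, smul_eq_mul, Finset.smul_sum,
          RingHom.id_apply, C_mul', mul_smul] }
  let s : Set (Submodule k (ι → k)) := ⋃ b : β,
    (fun p : Ideal (MvPolynomial ι k) => (p.restrictScalars k).comap lin) ''
      associatedPrimes (MvPolynomial ι k) (MvPolynomial ι k ⧸ K b)
  have hs : s.Finite := Set.finite_iUnion fun b => (associatedPrimes.finite _ _).image _
  have htop : ⊤ ∉ hs.toFinset := by
    rw [Set.Finite.mem_toFinset]
    intro h
    obtain ⟨b, p, hp, hpt⟩ := Set.mem_iUnion.1 h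
    obtain ⟨x, hx, hxr⟩ := hK b
    refine (hreg b x).1 hxr p hp (Ideal.span_le.2 ?_ hx)
    rintro _ ⟨i, rfl⟩
    have : (Pi.single i 1 : ι → k) ∈ (p.restrictScalars k).comap lin := by
      simp only at hpt
      rw [hpt]; trivial
    have h' : linForm k (Pi.single i 1) ∈ p := this
    rwa [linForm_single] at h'
  have hne := Subspace.biUnion_ne_univ_of_top_notMem htop
  obtain ⟨c, hc⟩ := (Set.ne_univ_iff_exists_notMem _).1 hne
  refine ⟨c, fun b => (hreg b _).2 fun p hp hcp => hc ?_⟩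
  refine Set.mem_biUnion (x := (p.restrictScalars k).comap lin) ?_ hcp
  rw [Finset.mem_coe, Set.Finite.mem_toFinset]
  exact Set.mem_iUnion.2 ⟨b, p, hp, rfl⟩

/-- Over an infinite field a regular sequence in the irrelevant ideal can be replaced by one
consisting of linear forms. -/
lemma exists_linear_regSeq [Infinite k] {d : ℕ} {J : Ideal (MvPolynomial ι k)}
    {xs : List (MvPolynomial ι k)} (hlen : xs.length = d)
    (hxs : ∀ f ∈ xs, f ∈ Ideal.span (Set.range (X : ι → MvPolynomial ι k)))
    (h : RegSeq xs J) :
    ∃ cs : List (ι → k), cs.length = d ∧ RegSeq (cs.map (linForm k)) J := by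
  induction d generalizing J xs with
  | zero => exact ⟨[], rfl, regSeq_nil _⟩
  | succ d ih =>
    obtain ⟨c, hc⟩ := exists_linForm_regMod
      (fun i : Fin (d + 1) => J ⊔ Ideal.ofList (xs.take i))
      (fun i => by
        have hi : (i : ℕ) < xs.length := by have := i.2; omega
        exact ⟨xs[(i : ℕ)], hxs _ (List.getElem_mem _), h i hi⟩)
    have hl : (xs.take d).length = d := by rw [List.length_take]; omega
    have h1 : RegSeq (xs.take d) J := by
      intro i hi
      rw [hl] at hi
      have := h i (by omega)
      rw [List.getElem_take, List.take_take, min_eq_left hi.le]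
      exact this
    have h2 : RegSeq (xs.take d) (J ⊔ Ideal.span {linForm k c}) := by
      refine regSeq_sup_of_regMod h1 fun i hi => ?_
      rw [hl] at hi
      rw [List.take_take, min_eq_left hi]
      exact hc ⟨i, by omega⟩
    obtain ⟨cs, hcs, hreg⟩ := ih hl (fun f hf => hxs f (List.mem_of_mem_take hf)) h2
    refine ⟨c :: cs, by rw [List.length_cons, hcs], ?_⟩
    rw [List.map_cons]
    refine regSeq_cons.2 ⟨?_, hreg⟩
    simpa using hc 0

/-- The summation operator on numerical functions. -/
def psum (h : ℕ → ℕ) (m : ℕ) : ℕ := ∑ i ∈ Finset.range (m + 1), h i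

lemma psum_mono {f g : ℕ → ℕ} (h : f ≤ g) : psum f ≤ psum g :=
  fun _ => Finset.sum_le_sum fun i _ => h i

lemma psum_zero (f : ℕ → ℕ) : psum f 0 = f 0 := by simp [psum]

lemma psum_succ (f : ℕ → ℕ) (m : ℕ) : psum f (m + 1) = psum f m + f (m + 1) :=
  Finset.sum_range_succ _ _

lemma psum_injective : Function.Injective psum := by
  intro f g h
  funext m
  cases m with
  | zero => rw [← psum_zero f, ← psum_zero g, h]
  | succ m =>
    have h1 := psum_succ f m
    have h2 := psum_succ g m
    rw [h] at h1
    omega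

lemma iterate_psum_mono (d : ℕ) {f g : ℕ → ℕ} (h : f ≤ g) : psum^[d] f ≤ psum^[d] g := by
  induction d with
  | zero => exact h
  | succ d ih =>
    rw [Function.iterate_succ_apply', Function.iterate_succ_apply']
    exact psum_mono ih

lemma iterate_psum_zero (d : ℕ) (f : ℕ → ℕ) : psum^[d] f 0 = f 0 := by
  induction d with
  | zero => rfl
  | succ d ih => rw [Function.iterate_succ_apply', psum_zero, ih]

lemma regMod_of_homogeneous {ι : Type} {J : Ideal (MvPolynomial ι k)} (hJ : IsHomI J)
    {ℓ : MvPolynomial ι k} (hℓ : ℓ.IsHomogeneous 1)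
    (h : ∀ (m : ℕ) (f : MvPolynomial ι k), f.IsHomogeneous m → ℓ * f ∈ J → f ∈ J) :
    RegMod J ℓ := by
  intro f hf
  rw [← sum_homogeneousComponent f]
  refine Ideal.sum_mem _ fun m _ => h m _ (homogeneousComponent_isHomogeneous m f) ?_
  rw [mul_comm, ← homogeneousComponent_mul_linear hℓ, mul_comm]
  exact hJ _ hf _

lemma HFq_le_psum {J : Ideal (MvPolynomial ι k)} (hJ : IsHomI J)
    {ℓ : MvPolynomial ι k} (hℓ : ℓ.IsHomogeneous 1) :
    HFq k J ≤ psum (HFq k (J ⊔ Ideal.span {ℓ})) := by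
  intro m
  induction m with
  | zero => rw [psum_zero, HFq_sup_linear_zero hJ hℓ]
  | succ m ih =>
    rw [psum_succ]
    exact (HFq_succ_le hJ hℓ m).trans (Nat.add_le_add_right ih _)

lemma HFq_eq_psum_iff {J : Ideal (MvPolynomial ι k)} (hJ : IsHomI J)
    {ℓ : MvPolynomial ι k} (hℓ : ℓ.IsHomogeneous 1) :
    HFq k J = psum (HFq k (J ⊔ Ideal.span {ℓ})) ↔ RegMod J ℓ := by
  constructor
  · intro h
    refine regMod_of_homogeneous hJ hℓ fun m => (HFq_succ_eq_iff hJ hℓ m).1 ?_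
    conv_lhs => rw [h]
    conv_rhs => rw [h]
    rw [psum_succ]
  · intro h
    funext m
    induction m with
    | zero => rw [psum_zero, HFq_sup_linear_zero hJ hℓ]
    | succ m ih =>
      rw [psum_succ, ← ih]
      exact (HFq_succ_eq_iff hJ hℓ m).2 fun f _ => h f

lemma HFq_le_iterate_psum {J : Ideal (MvPolynomial ι k)} (hJ : IsHomI J)
    (cs : List (ι → k)) :
    HFq k J ≤ psum^[cs.length] (HFq k (J ⊔ Ideal.ofList (cs.map (linForm k)))) := by
  induction cs generalizing J with
  | nil => simp
  | cons c cs ih =>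
    have hc := linForm_isHomogeneous c
    rw [List.map_cons, Ideal.ofList_cons, ← sup_assoc, List.length_cons,
      Function.iterate_succ_apply']
    exact (HFq_le_psum hJ hc).trans (psum_mono (ih (hJ.sup (isHomI_span_singleton hc))))

/-- Linear forms form a regular sequence if and only if the Hilbert function of the quotient is as
small as possible. -/
lemma HFq_eq_iterate_psum_iff {J : Ideal (MvPolynomial ι k)} (hJ : IsHomI J)
    (cs : List (ι → k)) :
    HFq k J = psum^[cs.length] (HFq k (J ⊔ Ideal.ofList (cs.map (linForm k)))) ↔
      RegSeq (cs.map (linForm k)) J := by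
  induction cs generalizing J with
  | nil => simp [regSeq_nil]
  | cons c cs ih =>
    have hc := linForm_isHomogeneous c
    have hJ' := hJ.sup (isHomI_span_singleton hc)
    have h1 := HFq_le_psum hJ hc
    have h2 := HFq_le_iterate_psum hJ' cs
    rw [List.map_cons, regSeq_cons, ← HFq_eq_psum_iff hJ hc, ← ih hJ', Ideal.ofList_cons,
      ← sup_assoc, List.length_cons, Function.iterate_succ_apply']
    constructor
    · intro h
      have h3 : HFq k J = psum (HFq k (J ⊔ Ideal.span {linForm k c})) :=
        le_antisymm h1 ((psum_mono h2).trans h.ge)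
      exact ⟨h3, psum_injective (h3.symm.trans h)⟩
    · rintro ⟨h3, h4⟩
      rw [← h4]
      exact h3

lemma HFq_eq_zero_of_le {J : Ideal (MvPolynomial ι k)} {m n : ℕ} (hmn : m ≤ n)
    (h : HFq k J m = 0) : HFq k J n = 0 := by
  rw [HFq_eq_zero] at h ⊢
  intro f hf
  rw [f.as_sum]
  refine Ideal.sum_mem _ fun u hu => ?_
  have hu' : u.degree = n := by
    by_contra hne
    exact (mem_support_iff.1 hu) (hf.coeff_eq_zero hne)
  obtain ⟨v, hvu, hv⟩ : ∃ v ≤ u, v.degree = m := by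
    rw [← hu'] at hmn
    exact Finsupp.exists_le_degree_eq _ _ hmn
  rw [← tsub_add_cancel_of_le hvu, ← mul_one (coeff _ f), ← monomial_mul]
  exact Ideal.mul_mem_left _ _ (h _ (isHomogeneous_monomial _ hv))

/-- A homogeneous ideal with zero-dimensional quotient contains all forms of large degree. -/
lemma exists_HFq_eq_zero {J : Ideal (MvPolynomial ι k)} (hJ : IsHomI J)
    (hdim : ringKrullDim (MvPolynomial ι k ⧸ J) ≤ 0) : ∃ N, HFq k J N = 0 := by
  classical
  have : Ring.KrullDimLE 0 (MvPolynomial ι k ⧸ J) := by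
    rw [Ring.krullDimLE_iff]
    exact_mod_cast hdim
  have : IsArtinianRing (MvPolynomial ι k ⧸ J) := isArtinianRing_iff_krullDimLE_zero.2 this
  have hX : ∀ i : ι, ∃ n : ℕ, (X i : MvPolynomial ι k) ^ n ∈ J := by
    intro i
    obtain ⟨n, y, hy⟩ := IsArtinian.exists_pow_succ_smul_dvd
      (Ideal.Quotient.mk J (X i)) (1 : MvPolynomial ι k ⧸ J)
    obtain ⟨g, rfl⟩ := Ideal.Quotient.mk_surjective y
    refine ⟨n, ?_⟩
    have hmem : X i ^ (n + 1) * g - X i ^ n ∈ J := by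
      rw [← Ideal.Quotient.eq_zero_iff_mem, map_sub, map_mul, map_pow, map_pow, sub_eq_zero]
      simpa using hy
    have h := hJ _ hmem n
    have h0 : homogeneousComponent n (X i ^ (n + 1) * g) = 0 := by
      ext u
      rw [coeff_homogeneousComponent, coeff_zero]
      split_ifs with hu
      · rw [X_pow_eq_monomial, coeff_monomial_mul', if_neg]
        intro hle
        have := Finsupp.degree_mono hle
        rw [Finsupp.degree_single] at this
        omega
      · rfl
    rw [map_sub, h0, homogeneousComponent_eq_self (isHomogeneous_X_pow i n), zero_sub] at h
    exact J.neg_mem_iff.1 h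
  choose n hn using hX
  refine ⟨(∑ i, n i) + 1, HFq_eq_zero.2 fun f hf => ?_⟩
  rw [f.as_sum]
  refine Ideal.sum_mem _ fun u hu => ?_
  have hu' : u.degree = (∑ i, n i) + 1 := by
    by_contra hne
    exact (mem_support_iff.1 hu) (hf.coeff_eq_zero hne)
  obtain ⟨i, hi⟩ : ∃ i, n i ≤ u i := by
    by_contra! hlt
    have h1 : u.degree = ∑ i, u i := Finsupp.degree_eq_sum u
    have h2 : ∑ i, u i ≤ ∑ i, n i := Finset.sum_le_sum fun i _ => (hlt i).le
    omega
  have hle : Finsupp.single i (n i) ≤ u := by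
    rw [Finsupp.single_le_iff]; exact hi
  rw [← tsub_add_cancel_of_le hle, ← mul_one (coeff _ f), ← monomial_mul, ← X_pow_eq_monomial]
  exact Ideal.mul_mem_left _ _ (hn i)

end LinearRegularSequences

section Reductions

variable {k : Type} [Field k] {ι τ : Type} [Fintype ι]

lemma polyFamily_span_linForm {κ : Type} (a : κ → ι → MvPolynomial τ k) :
    PolyFamily fun x : τ → k =>
      Ideal.span (Set.range fun j => linForm k fun i => eval x (a j i)) := by
  refine ⟨κ, fun j => ∑ i, C (a j i) * X i, fun _ => 1, fun j => ?_, fun x => ?_⟩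
  · exact IsHomogeneous.sum _ _ _ fun i _ => by
      simpa using (isHomogeneous_C ι (a j i)).mul (isHomogeneous_X _ i)
  · simp [linForm, map_sum]

lemma eval_bind₁ {σ : Type} (a : τ → MvPolynomial σ k) (x : σ → k) (g : MvPolynomial τ k) :
    eval x (bind₁ a g) = eval (fun t => eval x (a t)) g :=
  eval₂Hom_bind₁ _ _ _ _

lemma exists_eval_ne_zero [Infinite k] {g : MvPolynomial τ k} (hg : g ≠ 0) :
    ∃ x, eval x g ≠ 0 := by
  by_contra! h
  exact hg (MvPolynomial.funext fun x => by rw [h, map_zero])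

lemma PolyFamily.comp {ι σ : Type} {J : (τ → k) → Ideal (MvPolynomial ι k)} (hJ : PolyFamily J)
    (a : τ → MvPolynomial σ k) : PolyFamily fun x : σ → k => J fun t => eval x (a t) := by
  obtain ⟨κ, F, e, hF, hJ⟩ := hJ
  refine ⟨κ, fun i => map (bind₁ a : MvPolynomial τ k →ₐ[k] MvPolynomial σ k).toRingHom (F i), e,
    fun i => (hF i).map _, fun x => ?_⟩
  change J _ = _
  rw [hJ]
  congr 2
  funext i
  rw [map_map]
  congr 2
  ext t <;> simp

lemma polyFamily_redIdeal {J : Ideal (MvPolynomial ι k)} (hJ : IsHomI J) (d : ℕ) :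
    PolyFamily fun c : Fin d × ι → k => redIdeal k J c := by
  have := (polyFamily_const (τ := Fin d × ι) hJ).sup
    (polyFamily_span_linForm fun (j : Fin d) (i : ι) => X (j, i))
  simpa only [redIdeal, eval_X] using this

lemma polyFamily_redIdeal_sup {J : Ideal (MvPolynomial ι k)} (hJ : IsHomI J) (d : ℕ) :
    PolyFamily fun x : (Fin d × ι) ⊕ ι → k =>
      redIdeal k J (fun p => x (Sum.inl p)) ⊔ Ideal.span {linForm k fun i => x (Sum.inr i)} := by
  have h1 := (polyFamily_redIdeal hJ d).comp (fun p => (X (Sum.inl p) : MvPolynomial (_ ⊕ ι) k))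
  have h2 := polyFamily_span_linForm
    (fun (_ : Unit) (i : ι) => (X (Sum.inr i) : MvPolynomial ((Fin d × ι) ⊕ ι) k))
  simpa only [eval_X, Set.range_const] using h1.sup h2

lemma redIdeal_isHomI {J : Ideal (MvPolynomial ι k)} (hJ : IsHomI J) {d : ℕ}
    (c : Fin d × ι → k) : IsHomI (redIdeal k J c) :=
  (polyFamily_redIdeal hJ d).isHomI c

/-- The list of coefficient vectors of the linear forms encoded by `c`. -/
def coeffList {k ι : Type} {d : ℕ} (c : Fin d × ι → k) : List (ι → k) := List.ofFn fun j i => c (j, i)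

lemma length_coeffList {k ι : Type} {d : ℕ} (c : Fin d × ι → k) : (coeffList c).length = d :=
  List.length_ofFn

lemma exists_coeffList {k ι : Type} (cs : List (ι → k)) :
    ∃ c : Fin cs.length × ι → k, coeffList c = cs :=
  ⟨fun p => cs.get p.1 p.2, List.ofFn_get cs⟩

lemma redIdeal_eq {d : ℕ} (J : Ideal (MvPolynomial ι k)) (c : Fin d × ι → k) :
    redIdeal k J c = J ⊔ Ideal.ofList ((coeffList c).map (linForm k)) := by
  rw [redIdeal, Ideal.ofList]
  congr 2
  ext f
  simp [coeffList]

lemma HFq_redIdeal_eq {J : Ideal (MvPolynomial ι k)} (hJ : IsHomI J) {d : ℕ} {h : ℕ → ℕ}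
    (hle : psum^[d] h ≤ HFq k J) {c : Fin d × ι → k}
    (hc : ∀ m, HFq k (redIdeal k J c) m ≤ h m) :
    HFq k (redIdeal k J c) = h ∧ RegSeq ((coeffList c).map (linForm k)) J := by
  have h1 := HFq_le_iterate_psum hJ (coeffList c)
  rw [← redIdeal_eq, length_coeffList] at h1
  have h2 : psum^[d] (HFq k (redIdeal k J c)) ≤ psum^[d] h := iterate_psum_mono d hc
  have h3 : HFq k J = psum^[d] (HFq k (redIdeal k J c)) := le_antisymm h1 (h2.trans hle)
  refine ⟨psum_injective.iterate d (le_antisymm h2 (hle.trans h3.le)), ?_⟩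
  rw [← HFq_eq_iterate_psum_iff hJ, ← redIdeal_eq, length_coeffList]
  exact h3

lemma PolyFamily.openAt_forall_HFq_le {J : (τ → k) → Ideal (MvPolynomial ι k)} (hJ : PolyFamily J)
    {x₀ : τ → k} {N : ℕ} (hN : HFq k (J x₀) N = 0) :
    OpenAt x₀ fun x => ∀ m, HFq k (J x) m ≤ HFq k (J x₀) m := by
  obtain ⟨g, hg, H⟩ := OpenAt.forall_lt (fun m => hJ.openAt_HFq_le x₀ m) (N + 1)
  refine ⟨g, hg, fun x hx m => ?_⟩
  rcases lt_or_ge m (N + 1) with hm | hm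
  · exact H x hx m hm
  · have h0 := H x hx N (Nat.lt_succ_self N)
    rw [hN, Nat.le_zero] at h0
    rw [HFq_eq_zero_of_le (Nat.le_of_succ_le hm) h0]
    exact Nat.zero_le _

/-- A single good reduction yields the weak Lefschetz property for general reductions. -/
lemma generic_artWLP {J : Ideal (MvPolynomial ι k)} (hJ : IsHomI J) {d : ℕ} {h : ℕ → ℕ}
    (hle : psum^[d] h ≤ HFq k J) {N : ℕ} (hN : h N = 0)
    (c₀ : Fin d × ι → k) (hc₀ : ∀ m, HFq k (redIdeal k J c₀) m ≤ h m) (w₀ : ι → k)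
    (hw₀ : ∀ m, HFq k (redIdeal k J c₀ ⊔ Ideal.span {linForm k w₀}) (m + 1) ≤ h (m + 1) - h m) :
    Generic k (Fin d × ι) fun c => artWLP k (redIdeal k J c) := by
  have hN₁ : HFq k (redIdeal k J c₀) N = 0 := Nat.le_zero.1 (hN ▸ hc₀ N)
  have hN₂ : HFq k (redIdeal k J c₀ ⊔ Ideal.span {linForm k w₀}) N = 0 :=
    Nat.le_zero.1 (hN₁ ▸ HFq_anti le_sup_left N)
  have hfam₁ := (polyFamily_redIdeal hJ d).comp
    (fun p => (X (Sum.inl p) : MvPolynomial ((Fin d × ι) ⊕ ι) k))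
  simp only [eval_X] at hfam₁
  have hfam₂ := polyFamily_redIdeal_sup hJ d
  let x₀ : (Fin d × ι) ⊕ ι → k := Sum.elim c₀ w₀
  obtain ⟨g, hg, H⟩ := (hfam₁.openAt_forall_HFq_le (x₀ := x₀) (N := N) hN₁).and
    (hfam₂.openAt_forall_HFq_le (x₀ := x₀) (N := N) hN₂)
  have key : ∀ (c : Fin d × ι → k) (w : ι → k), eval (Sum.elim c w) g ≠ 0 →
      ∀ m, mulMaxRank k (redIdeal k J c) (Ideal.Quotient.mk _ (linForm k w)) m := by
    intro c w hcw m
    obtain ⟨h1, h2⟩ := H _ hcw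
    have h3 : HFq k (redIdeal k J c) = h := (HFq_redIdeal_eq hJ hle fun m => (h1 m).trans (hc₀ m)).1
    rw [mulMaxRank_iff (redIdeal_isHomI hJ c) (linForm_isHomogeneous w), h3]
    exact (h2 (m + 1)).trans (hw₀ m)
  let g₁ : MvPolynomial (Fin d × ι) k :=
    bind₁ (Sum.elim (fun p => X p) fun i => C (w₀ i)) g
  have hg₁ : ∀ c, eval c g₁ = eval (Sum.elim c w₀) g := by
    intro c
    rw [eval_bind₁]
    congr 2
    funext t
    rcases t with t | t <;> simp
  refine ⟨g₁, ?_, fun c hc => ?_⟩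
  · intro h0
    apply hg
    rw [← hg₁, h0, map_zero]
  · rw [hg₁] at hc
    let g₂ : MvPolynomial ι k := bind₁ (Sum.elim (fun p => C (c p)) fun i => X i) g
    have hg₂ : ∀ w, eval w g₂ = eval (Sum.elim c w) g := by
      intro w
      rw [eval_bind₁]
      congr 2
      funext t
      rcases t with t | t <;> simp
    refine ⟨g₂, ?_, fun w hw => key c w ?_⟩
    · intro h0
      apply hc
      rw [← hg₂, h0, map_zero]
    · rwa [← hg₂]

/-- If a Cohen-Macaulay graded quotient has the weak Lefschetz property then there is a good
reduction, whose Hilbert function is dictated by that of the quotient. -/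
lemma exists_good_reduction [Infinite k] {J : Ideal (MvPolynomial ι k)} (hJ : IsHomI J) {d : ℕ}
    (h : hasWLP k J d) :
    ∃ (H : ℕ → ℕ) (N : ℕ) (c : Fin d × ι → k) (w : ι → k), HFq k J = psum^[d] H ∧ H 0 ≠ 0 ∧
      H N = 0 ∧
      (∀ m, HFq k (redIdeal k J c) m = H m) ∧
      ∀ m, HFq k (redIdeal k J c ⊔ Ideal.span {linForm k w}) (m + 1) ≤ H (m + 1) - H m := by
  obtain ⟨⟨hdim, rs, hlen, hrs, hreg⟩, g, hg, hgen⟩ := h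
  obtain ⟨cs, rfl, hcs⟩ := exists_linear_regSeq hlen hrs (isWeaklyRegular_iff_regSeq.1 hreg.1)
  obtain ⟨c₁, hc₁⟩ := exists_coeffList cs
  have hH := (HFq_eq_iterate_psum_iff hJ cs).2 hcs
  have hdim₁ := ringKrullDim_add_length_le hcs
  rw [← hc₁, ← redIdeal_eq, length_coeffList] at hH
  rw [← hc₁, ← redIdeal_eq, List.length_map, length_coeffList, hdim] at hdim₁
  obtain ⟨N, hN⟩ := exists_HFq_eq_zero (redIdeal_isHomI hJ c₁)
    (ENat.WithBot.add_le_add_natCast_right_iff.1 (hdim₁.trans (zero_add _).ge))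
  obtain ⟨g₁, hg₁, hgen₁⟩ := (polyFamily_redIdeal hJ cs.length).openAt_forall_HFq_le hN
  have hne : g * g₁ ≠ 0 := mul_ne_zero hg fun h0 => hg₁ (by rw [h0, map_zero])
  obtain ⟨c, hc⟩ := exists_eval_ne_zero hne
  rw [map_mul] at hc
  obtain ⟨g₂, hg₂, hgen₂⟩ := hgen c (left_ne_zero_of_mul hc)
  obtain ⟨w, hw⟩ := exists_eval_ne_zero hg₂
  have hcH := (HFq_redIdeal_eq hJ hH.ge (hgen₁ c (right_ne_zero_of_mul hc))).1
  have hJne : J ≠ ⊤ := by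
    rintro rfl
    have : Subsingleton (MvPolynomial ι k ⧸ (⊤ : Ideal (MvPolynomial ι k))) :=
      Ideal.Quotient.subsingleton_iff.2 rfl
    rw [ringKrullDim_eq_bot_of_subsingleton] at hdim
    exact WithBot.bot_ne_coe hdim
  have hH₀ := HFq_zero_ne_of_ne_top hJne
  rw [hH, iterate_psum_zero] at hH₀
  refine ⟨_, N, c, w, hH, hH₀, hN, congrFun hcH, fun m => ?_⟩
  have := (mulMaxRank_iff (redIdeal_isHomI hJ c) (linForm_isHomogeneous w) m).1 (hgen₂ w hw m)
  rwa [hcH] at this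

end Reductions

section MonomialIdeals

variable {k : Type} [Field k] {ι : Type}

variable (k) in
/-- The ideal spanned by the monomials with exponents in `P`. -/
def monIdeal (P : Set (ι →₀ ℕ)) : Ideal (MvPolynomial ι k) :=
  Ideal.span ((fun u => monomial u (1 : k)) '' P)

lemma mem_monIdeal {P : Set (ι →₀ ℕ)} (hP : IsUpperSet P) {f : MvPolynomial ι k} :
    f ∈ monIdeal k P ↔ ∀ u ∈ f.support, u ∈ P := by
  rw [monIdeal, mem_ideal_span_monomial_image]
  exact forall₂_congr fun u _ => ⟨fun ⟨v, hv, hvu⟩ => hP hvu hv, fun h => ⟨u, h, le_rfl⟩⟩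

lemma monIdeal_sup (P Q : Set (ι →₀ ℕ)) : monIdeal k P ⊔ monIdeal k Q = monIdeal k (P ∪ Q) := by
  rw [monIdeal, monIdeal, monIdeal, Set.image_union, Ideal.span_union]

lemma monomial_mem_of_le {J : Ideal (MvPolynomial ι k)} {u v : ι →₀ ℕ} (huv : u ≤ v)
    (hu : monomial u (1 : k) ∈ J) : monomial v (1 : k) ∈ J := by
  rw [← tsub_add_cancel_of_le huv, ← mul_one (1 : k), ← monomial_mul]
  exact Ideal.mul_mem_left _ _ hu

lemma monIdeal_le {P : Set (ι →₀ ℕ)} {J : Ideal (MvPolynomial ι k)}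
    (h : ∀ u ∈ P, monomial u (1 : k) ∈ J) : monIdeal k P ≤ J := by
  rw [monIdeal, Ideal.span_le]
  rintro _ ⟨u, hu, rfl⟩
  exact h u hu

lemma monomial_mem_monIdeal {P : Set (ι →₀ ℕ)} {u : ι →₀ ℕ} (hu : u ∈ P) :
    monomial u (1 : k) ∈ monIdeal k P := Ideal.subset_span ⟨u, hu, rfl⟩

lemma isHomI_monIdeal (P : Set (ι →₀ ℕ)) : IsHomI (monIdeal k P) :=
  isHomI_span _ (by rintro _ ⟨u, -, rfl⟩; exact ⟨u.degree, isHomogeneous_monomial _ rfl⟩)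

lemma finite_setOf_degree_eq [Finite ι] (m : ℕ) : {u : ι →₀ ℕ | u.degree = m}.Finite := by
  have := Fintype.ofFinite ι
  classical
  refine (Finset.finite_toSet (Finset.finsuppAntidiag Finset.univ m)).subset fun u hu => ?_
  rw [Finset.mem_coe, Finset.mem_finsuppAntidiag]
  exact ⟨by rw [← Finsupp.degree_eq_sum]; exact hu, Finset.subset_univ _⟩

lemma finrank_restrictSupport (s : Set (ι →₀ ℕ)) :
    Module.finrank k (restrictSupport k s) = s.ncard :=
  Module.finrank_eq_nat_card_basis (basisRestrictSupport k s)

/-- The Hilbert function of a monomial ideal counts the monomials outside the ideal. -/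
lemma HFq_monIdeal [Fintype ι] {P : Set (ι →₀ ℕ)} (hP : IsUpperSet P) (m : ℕ) :
    HFq k (monIdeal k P) m = {u : ι →₀ ℕ | u.degree = m ∧ u ∉ P}.ncard := by
  have h := HFq_add (monIdeal k P) m
  have h1 : homogeneousSubmodule ι k m = restrictSupport k {u : ι →₀ ℕ | u.degree = m} :=
    homogeneousSubmodule_eq_finsupp_supported _ _ _
  have h2 : (homogeneousSubmodule ι k m ⊓ (monIdeal k P).restrictScalars k :
      Submodule k (MvPolynomial ι k)) =
      restrictSupport k {u : ι →₀ ℕ | u.degree = m ∧ u ∈ P} := by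
    ext f
    rw [h1, Submodule.mem_inf, Submodule.restrictScalars_mem, mem_monIdeal hP,
      mem_restrictSupport_iff, mem_restrictSupport_iff]
    exact ⟨fun h u hu => ⟨h.1 hu, h.2 u hu⟩, fun h => ⟨fun u hu => (h hu).1, fun u hu => (h hu).2⟩⟩
  rw [h2, h1, finrank_restrictSupport, finrank_restrictSupport] at h
  have hfin := finite_setOf_degree_eq (ι := ι) m
  have h3 := Set.ncard_inter_add_ncard_sdiff_eq_ncard {u : ι →₀ ℕ | u.degree = m} P hfin
  have h4 : {u : ι →₀ ℕ | u.degree = m} ∩ P = {u | u.degree = m ∧ u ∈ P} := rfl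
  have h5 : {u : ι →₀ ℕ | u.degree = m} \ P = {u | u.degree = m ∧ u ∉ P} := rfl
  rw [h4, h5] at h3
  omega

/-- If every squarefree monomial outside an ideal has degree at most `d`, then the quotient has
Krull dimension at most `d`. -/
lemma ringKrullDim_quotient_le [Fintype ι] {J : Ideal (MvPolynomial ι k)} {d : ℕ}
    (h : ∀ F : Finset ι, (∏ i ∈ F, X i : MvPolynomial ι k) ∉ J → F.card ≤ d) :
    ringKrullDim (MvPolynomial ι k ⧸ J) ≤ d := by
  classical
  rw [ringKrullDim_quotient]
  refine iSup_le fun p => ?_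
  let p₀ := (p 0).1.asIdeal
  let F : Finset ι := Finset.univ.filter fun i => X i ∉ p₀
  have hF : F.card ≤ d := by
    refine h F fun hmem => ?_
    have h1 : (∏ i ∈ F, X i : MvPolynomial ι k) ∈ p₀ := (p 0).2 hmem
    obtain ⟨i, hi, hi'⟩ := ((p 0).1.2.prod_mem_iff).1 h1
    exact (Finset.mem_filter.1 hi).2 hi'
  let K : Ideal (MvPolynomial ι k) := Ideal.span (X '' {i | i ∉ F})
  have hK : K ≤ p₀ := by
    rw [Ideal.span_le]
    rintro _ ⟨i, hi, rfl⟩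
    by_contra hne
    exact hi (Finset.mem_filter.2 ⟨Finset.mem_univ _, hne⟩)
  let p' : LTSeries (PrimeSpectrum.zeroLocus (R := MvPolynomial ι k) K) :=
    LTSeries.mk p.length (fun i => ⟨(p i).1, fun x hx => by
      have h0 : p 0 ≤ p i := p.strictMono.monotone (Fin.zero_le _)
      exact h0 (hK hx)⟩) fun i j hij => p.strictMono hij
  have h1 : (p'.length : WithBot ℕ∞) ≤ ringKrullDim (MvPolynomial ι k ⧸ K) := by
    rw [ringKrullDim_quotient]
    exact Order.LTSeries.length_le_krullDim p'
  refine h1.trans ?_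
  let φ : MvPolynomial F k →ₐ[k] MvPolynomial ι k ⧸ K :=
    (Ideal.Quotient.mkₐ k K).comp (rename Subtype.val)
  have hφ : Function.Surjective φ := by
    let ρ : MvPolynomial ι k →ₐ[k] MvPolynomial F k :=
      aeval fun i => if hi : i ∈ F then X ⟨i, hi⟩ else 0
    have : φ.comp ρ = Ideal.Quotient.mkₐ k K := by
      ext i
      by_cases hi : i ∈ F
      · simp [ρ, φ, hi]
      · have : (Ideal.Quotient.mk K (X i) : MvPolynomial ι k ⧸ K) = 0 :=
          Ideal.Quotient.eq_zero_iff_mem.2 (Ideal.subset_span ⟨i, hi, rfl⟩)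
        simp [ρ, hi, this]
    intro y
    obtain ⟨f, rfl⟩ := Ideal.Quotient.mk_surjective y
    exact ⟨ρ f, congrArg (fun g : MvPolynomial ι k →ₐ[k] _ => g f) this⟩
  refine (ringKrullDim_le_of_surjective φ.toRingHom hφ).trans ?_
  rw [MvPolynomial.ringKrullDim_of_isNoetherianRing, ringKrullDim_eq_zero_of_field, zero_add,
    Nat.card_eq_fintype_card, Fintype.card_coe]
  exact_mod_cast hF

end MonomialIdeals

section FaceIdeals

variable {k : Type} [Field k] {n : ℕ}

/-- The exponent vector of a squarefree monomial. -/
def sqf {ι : Type} (t : Finset ι) : ι →₀ ℕ := ∑ i ∈ t, Finsupp.single i 1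

lemma sqf_apply {ι : Type} [DecidableEq ι] (t : Finset ι) (i : ι) :
    sqf t i = if i ∈ t then 1 else 0 := by
  rw [sqf, Finsupp.finsetSum_apply]
  simp [Finsupp.single_apply]

lemma degree_sqf {ι : Type} (t : Finset ι) : (sqf t).degree = t.card := by
  rw [sqf, map_sum]
  simp

lemma support_sqf {ι : Type} (t : Finset ι) : (sqf t).support = t := by
  classical
  ext i
  rw [Finsupp.mem_support_iff, sqf_apply]
  split_ifs with h <;> simp [h]

lemma sqf_le_iff {ι : Type} {t : Finset ι} {u : ι →₀ ℕ} : sqf t ≤ u ↔ t ⊆ u.support := by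
  classical
  constructor
  · intro h i hi
    have := h i
    rw [sqf_apply, if_pos hi] at this
    exact Finsupp.mem_support_iff.2 (by omega)
  · intro h i
    rw [sqf_apply]
    split_ifs with hi
    · exact Nat.one_le_iff_ne_zero.2 (Finsupp.mem_support_iff.1 (h hi))
    · exact Nat.zero_le _

lemma prod_X_eq_monomial {ι : Type} (t : Finset ι) :
    (∏ i ∈ t, X i : MvPolynomial ι k) = monomial (sqf t) 1 :=
  (monomial_sum_one t fun i => Finsupp.single i 1).symm

/-- The support of the `x`-part of a monomial of `R[T]`. -/
def xSupp (u : Fin (n + 1) →₀ ℕ) : Finset (Fin n) := Finset.univ.filter fun i => u i.castSucc ≠ 0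

lemma mem_xSupp {u : Fin (n + 1) →₀ ℕ} {i : Fin n} : i ∈ xSupp u ↔ u i.castSucc ≠ 0 := by
  simp [xSupp]

lemma xSupp_mono {u v : Fin (n + 1) →₀ ℕ} (h : u ≤ v) : xSupp u ⊆ xSupp v := by
  intro i hi
  rw [mem_xSupp] at hi ⊢
  have := h i.castSucc
  omega

/-- The exponent vector in `R[T]` of a monomial of `R`. -/
def extExp (v : Fin n →₀ ℕ) : Fin (n + 1) →₀ ℕ := v.mapDomain Fin.castSucc

lemma extExp_castSucc (v : Fin n →₀ ℕ) (i : Fin n) : extExp v i.castSucc = v i :=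
  Finsupp.mapDomain_apply (Fin.castSucc_injective n) v i

lemma extExp_last (v : Fin n →₀ ℕ) : extExp v (Fin.last n) = 0 :=
  Finsupp.mapDomain_of_notMem_range v _ (by
    rintro ⟨i, hi⟩
    exact (Fin.castSucc_lt_last i).ne hi)

lemma xSupp_extExp (v : Fin n →₀ ℕ) : xSupp (extExp v) = v.support := by
  ext i
  rw [mem_xSupp, extExp_castSucc, Finsupp.mem_support_iff]

lemma extExp_sqf_le_iff {t : Finset (Fin n)} {u : Fin (n + 1) →₀ ℕ} :
    extExp (sqf t) ≤ u ↔ t ⊆ xSupp u := by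
  constructor
  · intro h
    have := xSupp_mono h
    rwa [xSupp_extExp, support_sqf] at this
  · intro h i
    induction i using Fin.lastCases with
    | last => rw [extExp_last]; exact Nat.zero_le _
    | cast i =>
      rw [extExp_castSucc, sqf_apply]
      split_ifs with hi
      · exact Nat.one_le_iff_ne_zero.2 (mem_xSupp.1 (h hi))
      · exact Nat.zero_le _

lemma toT_monomial (v : Fin n →₀ ℕ) (c : k) :
    toT k (monomial v c) = monomial (extExp v) c := rename_monomial _ _ _

lemma mem_srIdeal {D : SC n} {f : MvPolynomial (Fin n) k} :
    f ∈ srIdeal k D ↔ ∀ u ∈ f.support, u.support ∉ D.faces := by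
  have h : srIdeal k D = monIdeal k (sqf '' {s | s ∉ D.faces}) := by
    rw [srIdeal, monIdeal, Set.image_image]
    congr 1
    ext p
    simp only [Set.mem_ofPred_eq, Set.mem_image, prod_X_eq_monomial, eq_comm]
  rw [h, monIdeal, mem_ideal_span_monomial_image]
  refine forall₂_congr fun u _ => ?_
  constructor
  · rintro ⟨_, ⟨s, hs, rfl⟩, hsu⟩ hu
    exact hs (D.down_closed _ hu _ (sqf_le_iff.1 hsu))
  · intro hu
    exact ⟨_, ⟨u.support, hu, rfl⟩, sqf_le_iff.2 subset_rfl⟩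

lemma support_add_exp {ι : Type} [DecidableEq ι] (u v : ι →₀ ℕ) :
    (u + v).support = u.support ∪ v.support := by
  ext i
  simp only [Finsupp.mem_support_iff, Finsupp.add_apply, Finset.mem_union]
  omega

lemma mem_linkIdeal {D : SC n} {σ : Finset (Fin n)} {f : MvPolynomial (Fin n) k} :
    f ∈ linkIdeal k D σ ↔ ∀ u ∈ f.support, u.support ∪ σ ∉ D.faces := by
  rw [linkIdeal, Ideal.mem_colon_span_singleton, xFace, prod_X_eq_monomial, mem_srIdeal]
  constructor
  · intro h u hu
    have := h (u + sqf σ) (by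
      rw [mem_support_iff, coeff_mul_monomial, mul_one]
      exact mem_support_iff.1 hu)
    rwa [support_add_exp, support_sqf] at this
  · intro h u hu
    rw [mem_support_iff, coeff_mul_monomial'] at hu
    split_ifs at hu with hle
    · rw [mul_one] at hu
      have := h _ (mem_support_iff.2 hu)
      rw [← tsub_add_cancel_of_le hle, support_add_exp, support_sqf]
      exact this
    · exact absurd rfl hu

/-- Exponents of monomials of `R[T]` whose `x`-part is not supported on a face. -/
def nonFaceExp (D : SC n) : Set (Fin (n + 1) →₀ ℕ) := {u | xSupp u ∉ D.faces}

/-- Exponents of monomials divisible by `T` whose `x`-part is not supported on a face of the star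
of `σ`. -/
def nonLinkExp (D : SC n) (σ : Finset (Fin n)) : Set (Fin (n + 1) →₀ ℕ) :=
  {u | u (Fin.last n) ≠ 0 ∧ xSupp u ∪ σ ∉ D.faces}

lemma isUpperSet_nonFaceExp (D : SC n) : IsUpperSet (nonFaceExp D) :=
  fun _ _ huv hu hv => hu (D.down_closed _ hv _ (xSupp_mono huv))

lemma isUpperSet_nonLinkExp (D : SC n) (σ : Finset (Fin n)) : IsUpperSet (nonLinkExp D σ) := by
  rintro u v huv ⟨h1, h2⟩
  refine ⟨?_, fun hv => h2 (D.down_closed _ hv _ (Finset.union_subset_union_left (xSupp_mono huv)))⟩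
  have := huv (Fin.last n)
  omega

lemma isUpperSet_xSupp (σ : Finset (Fin n)) :
    IsUpperSet {u : Fin (n + 1) →₀ ℕ | σ ⊆ xSupp u} :=
  fun _ _ huv hu => hu.trans (xSupp_mono huv)

lemma isUpperSet_le_last (r : ℕ) :
    IsUpperSet {u : Fin (n + 1) →₀ ℕ | r ≤ u (Fin.last n)} :=
  fun _ _ huv hu => le_trans hu (huv _)

lemma extI_srIdeal (D : SC n) : extI k (srIdeal k D) = monIdeal k (nonFaceExp D) := by
  apply le_antisymm
  · rw [extI, Ideal.map_le_iff_le_comap, srIdeal, Ideal.span_le]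
    rintro _ ⟨s, hs, rfl⟩
    change toT k (∏ i ∈ s, X i) ∈ monIdeal k (nonFaceExp D)
    rw [prod_X_eq_monomial, toT_monomial]
    refine monomial_mem_monIdeal ?_
    rw [nonFaceExp, Set.mem_ofPred_eq, xSupp_extExp, support_sqf]
    exact hs
  · refine monIdeal_le fun u hu => ?_
    refine monomial_mem_of_le (extExp_sqf_le_iff.2 subset_rfl) ?_
    rw [← toT_monomial, ← prod_X_eq_monomial]
    exact Ideal.mem_map_of_mem _ (Ideal.subset_span ⟨_, hu, rfl⟩)

lemma Tv_pow (r : ℕ) : Tv k n ^ r = monomial (Finsupp.single (Fin.last n) r) 1 :=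
  X_pow_eq_monomial

lemma TmulI_linkIdeal (D : SC n) (σ : Finset (Fin n)) :
    TmulI k (linkIdeal k D σ) = monIdeal k (nonLinkExp D σ) := by
  apply le_antisymm
  · rw [TmulI, Ideal.span_le]
    rintro _ ⟨f, hf, rfl⟩
    rw [SetLike.mem_coe, mem_linkIdeal] at hf
    change Tv k n * toT k f ∈ monIdeal k (nonLinkExp D σ)
    rw [f.as_sum, map_sum, Finset.mul_sum]
    refine Ideal.sum_mem _ fun u hu => ?_
    rw [toT_monomial, ← pow_one (Tv k n), Tv_pow, monomial_mul, one_mul,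
      ← mul_one (coeff u f), ← smul_eq_mul, ← smul_monomial, smul_eq_C_mul]
    refine Ideal.mul_mem_left _ _ (monomial_mem_monIdeal ⟨?_, ?_⟩)
    · rw [Finsupp.add_apply, Finsupp.single_eq_same]
      omega
    · have : xSupp (Finsupp.single (Fin.last n) 1 + extExp u) = u.support := by
        rw [← xSupp_extExp]
        ext i
        rw [mem_xSupp, mem_xSupp, Finsupp.add_apply,
          Finsupp.single_eq_of_ne (Fin.castSucc_lt_last i).ne, zero_add]
      rw [this]
      exact hf u hu
  · refine monIdeal_le fun u hu => ?_
    have hle : Finsupp.single (Fin.last n) 1 + extExp (sqf (xSupp u)) ≤ u := by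
      intro i
      have h := (extExp_sqf_le_iff (u := u)).2 subset_rfl i
      have h1 := hu.1
      rw [Finsupp.add_apply]
      induction i using Fin.lastCases with
      | last => rw [extExp_last, Finsupp.single_eq_same]; omega
      | cast i => rwa [Finsupp.single_eq_of_ne (Fin.castSucc_lt_last i).ne, zero_add]
    refine monomial_mem_of_le hle ?_
    rw [← one_mul (1 : k), ← monomial_mul, ← Tv_pow, pow_one, ← toT_monomial]
    refine Ideal.subset_span ⟨_, ?_, rfl⟩
    rw [SetLike.mem_coe, mem_linkIdeal]
    intro v hv
    rw [Finset.mem_singleton.1 (support_monomial_subset hv), support_sqf]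
    exact hu.2

lemma span_toT_xFace (σ : Finset (Fin n)) :
    Ideal.span {toT k (xFace k σ)} = monIdeal k {u | σ ⊆ xSupp u} := by
  rw [xFace, prod_X_eq_monomial, toT_monomial]
  apply le_antisymm
  · rw [Ideal.span_singleton_le_iff_mem]
    exact monomial_mem_monIdeal (extExp_sqf_le_iff.1 le_rfl)
  · exact monIdeal_le fun u hu => monomial_mem_of_le (extExp_sqf_le_iff.2 hu)
      (Ideal.mem_span_singleton_self _)

lemma span_Tv_pow (r : ℕ) :
    Ideal.span {Tv k n ^ r} = monIdeal k {u | r ≤ u (Fin.last n)} := by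
  rw [Tv_pow]
  apply le_antisymm
  · rw [Ideal.span_singleton_le_iff_mem]
    refine monomial_mem_monIdeal ?_
    rw [Set.mem_ofPred_eq, Finsupp.single_eq_same]
  · exact monIdeal_le fun u hu => monomial_mem_of_le (Finsupp.single_le_iff.2 hu)
      (Ideal.mem_span_singleton_self _)

/-- Exponents of the monomials in the ideal `(I, T·I_L)`. -/
def baseExp (D : SC n) (σ : Finset (Fin n)) : Set (Fin (n + 1) →₀ ℕ) :=
  nonFaceExp D ∪ nonLinkExp D σ

lemma isUpperSet_baseExp (D : SC n) (σ : Finset (Fin n)) : IsUpperSet (baseExp D σ) :=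
  (isUpperSet_nonFaceExp D).union (isUpperSet_nonLinkExp D σ)

lemma Jst_eq_sup (D : SC n) (σ : Finset (Fin n)) :
    Jst k D σ = monIdeal k (baseExp D σ) ⊔ Ideal.span {toT k (xFace k σ)} := by
  rw [Jst, extI_srIdeal, TmulI_linkIdeal, sup_right_comm, monIdeal_sup, baseExp]

lemma IC_eq_sup (D : SC n) (σ : Finset (Fin n)) (q : ℕ) :
    IC k D σ q = monIdeal k (baseExp D σ) ⊔ Ideal.span {Tv k n ^ (q + 1)} := by
  rw [IC, extI_srIdeal, TmulI_linkIdeal, sup_right_comm, monIdeal_sup, baseExp]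

lemma Jst_eq (D : SC n) (σ : Finset (Fin n)) :
    Jst k D σ = monIdeal k (baseExp D σ ∪ {u | σ ⊆ xSupp u}) := by
  rw [Jst_eq_sup, span_toT_xFace, monIdeal_sup]

lemma IC_eq (D : SC n) (σ : Finset (Fin n)) (q : ℕ) :
    IC k D σ q = monIdeal k (baseExp D σ ∪ {u | q + 1 ≤ u (Fin.last n)}) := by
  rw [IC_eq_sup, span_Tv_pow, monIdeal_sup]

lemma isHomI_Jst (D : SC n) (σ : Finset (Fin n)) : IsHomI (Jst k D σ) := by
  rw [Jst_eq]
  exact isHomI_monIdeal _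

lemma isHomI_IC (D : SC n) (σ : Finset (Fin n)) (q : ℕ) : IsHomI (IC k D σ q) := by
  rw [IC_eq]
  exact isHomI_monIdeal _

end FaceIdeals

section HilbertFunctionComparison

variable {k : Type} [Field k] {n : ℕ}

lemma HFq_IC_le_HFq_Jst {q : ℕ} (D : SC n) (σ : Finset (Fin n)) (hcard : σ.card = q + 1) (m : ℕ) :
    HFq k (IC k D σ q) m ≤ HFq k (Jst k D σ) m := by
  rw [IC_eq, Jst_eq, HFq_monIdeal ((isUpperSet_baseExp D σ).union (isUpperSet_le_last _)),
    HFq_monIdeal ((isUpperSet_baseExp D σ).union (isUpperSet_xSupp σ))]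
  have hσ : σ.Nonempty := Finset.card_pos.1 (by omega)
  let r : (Fin (n + 1) →₀ ℕ) → ℕ := fun u => σ.inf' hσ fun i => u i.castSucc
  have hr : ∀ u, r u • extExp (sqf σ) ≤ u := by
    intro u i
    rw [Finsupp.smul_apply, smul_eq_mul]
    induction i using Fin.lastCases with
    | last => rw [extExp_last, mul_zero]; exact Nat.zero_le _
    | cast i =>
      rw [extExp_castSucc, sqf_apply]
      split_ifs with hi
      · rw [mul_one]
        exact Finset.inf'_le _ hi
      · rw [mul_zero]; exact Nat.zero_le _
  have hdeg : (extExp (sqf σ)).degree = q + 1 := by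
    rw [extExp, Finsupp.degree_mapDomain, degree_sqf, hcard]
  let Φ : (Fin (n + 1) →₀ ℕ) → (Fin (n + 1) →₀ ℕ) := fun u =>
    (u - r u • extExp (sqf σ)) + Finsupp.single (Fin.last n) (r u * (q + 1))
  have hlast : ∀ u, Φ u (Fin.last n) = u (Fin.last n) + r u * (q + 1) := by
    intro u
    simp only [Φ]
    rw [Finsupp.add_apply, Finsupp.tsub_apply, Finsupp.smul_apply, extExp_last,
      Finsupp.single_eq_same, smul_zero, tsub_zero]
  have hcast : ∀ u i, Φ u (Fin.castSucc i) = u i.castSucc - r u * sqf σ i := by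
    intro u i
    simp only [Φ]
    rw [Finsupp.add_apply, Finsupp.tsub_apply, Finsupp.smul_apply, extExp_castSucc,
      Finsupp.single_eq_of_ne (Fin.castSucc_lt_last i).ne, add_zero, smul_eq_mul]
  have hsub : ∀ u, xSupp (Φ u) ⊆ xSupp u := by
    intro u i hi
    rw [mem_xSupp, hcast] at hi
    rw [mem_xSupp]
    omega
  refine Set.ncard_le_ncard_of_injOn Φ ?_ ?_
    ((finite_setOf_degree_eq m).subset fun u hu => hu.1)
  · rintro u ⟨hum, hu⟩
    simp only [baseExp, nonFaceExp, nonLinkExp, Set.mem_union, Set.mem_ofPred_eq, not_or, not_and,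
      not_not] at hu
    obtain ⟨⟨h1, h2⟩, h3⟩ := hu
    refine ⟨?_, ?_⟩
    · have h4 := congrArg Finsupp.degree (tsub_add_cancel_of_le (hr u))
      simp only [Φ, map_add, map_nsmul, Finsupp.degree_single, hdeg, smul_eq_mul] at h4 ⊢
      omega
    · simp only [baseExp, nonFaceExp, nonLinkExp, Set.mem_union, Set.mem_ofPred_eq, not_or, not_and,
        not_not]
      refine ⟨⟨D.down_closed _ h1 _ (hsub u), fun h5 => ?_⟩, fun h5 => ?_⟩
      · rw [hlast] at h5
        by_cases hj : u (Fin.last n) = 0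
        · have hσu : σ ⊆ xSupp u := by
            intro i hi
            have : r u ≤ u i.castSucc := Finset.inf'_le _ hi
            have hr0 : r u ≠ 0 := by
              intro h0
              rw [hj, h0, zero_mul] at h5
              exact h5 rfl
            rw [mem_xSupp]
            omega
          exact D.down_closed _ h1 _ (Finset.union_subset (hsub u) hσu)
        · exact D.down_closed _ (h2 hj) _ (Finset.union_subset_union_left (hsub u))
      · obtain ⟨i, hi, hmin⟩ := Finset.exists_mem_eq_inf' hσ fun i => u i.castSucc
        have := mem_xSupp.1 (h5 hi)
        rw [hcast, sqf_apply, if_pos hi, mul_one] at this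
        exact this (by rw [← hmin]; exact Nat.sub_self _)
  · rintro u ⟨-, hu⟩ v ⟨-, hv⟩ huv
    simp only [Set.mem_union, Set.mem_ofPred_eq, not_or, not_le] at hu hv
    have hl : u (Fin.last n) + r u * (q + 1) = v (Fin.last n) + r v * (q + 1) := by
      rw [← hlast, ← hlast, huv]
    have hrr : r u = r v := by
      have h1 := congrArg (· / (q + 1)) hl
      simp only [Nat.add_mul_div_right _ _ (Nat.succ_pos q), Nat.div_eq_of_lt hu.2,
        Nat.div_eq_of_lt hv.2, zero_add] at h1
      exact h1
    have h1 : u - r u • extExp (sqf σ) = v - r v • extExp (sqf σ) := by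
      simp only [Φ, hrr] at huv
      rw [hrr]
      exact add_right_cancel huv
    rw [← tsub_add_cancel_of_le (hr u), ← tsub_add_cancel_of_le (hr v), h1, hrr]

lemma card_le_dimP {D : SC n} {s : Finset (Fin n)} (hs : s ∈ D.faces) : s.card ≤ dimP D :=
  Finset.le_sup (f := Finset.card) hs

lemma ringKrullDim_Jst_le (D : SC n) (σ : Finset (Fin n)) :
    ringKrullDim (MvPolynomial (Fin (n + 1)) k ⧸ Jst k D σ) ≤ dimP D := by
  refine ringKrullDim_quotient_le fun F hF => ?_
  rw [prod_X_eq_monomial, Jst_eq] at hF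
  have h := mt monomial_mem_monIdeal hF
  simp only [baseExp, nonFaceExp, nonLinkExp, Set.mem_union, Set.mem_ofPred_eq, not_or, not_and,
    not_not] at h
  obtain ⟨⟨h1, h2⟩, h3⟩ := h
  set u := sqf F with hu
  have hF' : F ⊆ insert (Fin.last n) ((xSupp u).map Fin.castSuccEmb) := by
    intro i hi
    induction i using Fin.lastCases with
    | last => exact Finset.mem_insert_self _ _
    | cast i =>
      refine Finset.mem_insert_of_mem (Finset.mem_map.2 ⟨i, ?_, rfl⟩)
      rw [mem_xSupp, hu, sqf_apply, if_pos hi]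
      exact one_ne_zero
  by_cases hl : Fin.last n ∈ F
  · have h4 := h2 (by rw [hu, sqf_apply, if_pos hl]; exact one_ne_zero)
    have h5 : (xSupp u).card < (xSupp u ∪ σ).card := by
      refine Finset.card_lt_card ⟨Finset.subset_union_left, fun h => h3 ?_⟩
      exact Finset.subset_union_right.trans h
    have h6 := card_le_dimP h4
    have h7 := (Finset.card_le_card hF').trans (Finset.card_insert_le _ _)
    rw [Finset.card_map] at h7
    omega
  · have h7 := Finset.card_le_card ((Finset.subset_insert_iff_of_notMem hl).1 hF')
    rw [Finset.card_map] at h7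
    exact h7.trans (card_le_dimP h1)

end HilbertFunctionComparison

section Degeneration

variable {k : Type} [Field k] {n : ℕ}

/-- The linear substitution `X j ↦ X j + w j * X t`. -/
def shear {ι : Type} (t : ι) (w : ι → k) : MvPolynomial ι k →ₐ[k] MvPolynomial ι k :=
  aeval fun j => X j + C (w j) * X t

lemma shear_X {ι : Type} (t : ι) (w : ι → k) (j : ι) :
    shear t w (X j) = X j + C (w j) * X t := aeval_X _ _

lemma shear_shear_neg {ι : Type} {t : ι} {w : ι → k} (hw : w t = 0) (f : MvPolynomial ι k) :
    shear t w (shear t (-w) f) = f := by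
  have : (shear t w).comp (shear t (-w)) = AlgHom.id k _ := by
    ext1 j
    rw [AlgHom.comp_apply, shear_X, map_add, map_mul, shear_X, shear_X, hw, ← algebraMap_eq,
      AlgHom.commutes, algebraMap_eq, Pi.neg_apply, C_0, C_neg, AlgHom.id_apply]
    ring
  exact congrArg (fun g : MvPolynomial ι k →ₐ[k] MvPolynomial ι k => g f) this

lemma shear_isHomogeneous {ι : Type} (t : ι) (w : ι → k) {f : MvPolynomial ι k} {m : ℕ}
    (hf : f.IsHomogeneous m) : (shear t w f).IsHomogeneous m := by
  have := hf.aeval (fun j => X j + C (w j) * X t) (n := 1) fun j =>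
    (isHomogeneous_X k j).add (by
      simpa using (isHomogeneous_C ι (w j)).mul (isHomogeneous_X k t))
  rwa [one_mul] at this

lemma X_dvd_shear_sub {ι : Type} (t : ι) (w : ι → k) (f : MvPolynomial ι k) :
    X t ∣ shear t w f - f := by
  have : (Ideal.Quotient.mkₐ k (Ideal.span {(X t : MvPolynomial ι k)})).comp (shear t w) =
      Ideal.Quotient.mkₐ k _ := by
    ext1 j
    have h0 : Ideal.Quotient.mk (Ideal.span {(X t : MvPolynomial ι k)}) (X t) = 0 :=
      Ideal.Quotient.eq_zero_iff_mem.2 (Ideal.mem_span_singleton_self _)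
    rw [AlgHom.comp_apply, shear_X, Ideal.Quotient.mkₐ_eq_mk, map_add, map_mul, h0, mul_zero,
      add_zero]
  rw [← Ideal.mem_span_singleton, ← Ideal.Quotient.eq]
  exact congrArg (fun g : MvPolynomial ι k →ₐ[k] _ => g f) this

lemma shear_monomial {ι : Type} (t : ι) (w : ι → k) {u : ι →₀ ℕ} (hu : ∀ j ∈ u.support, w j = 0) :
    shear t w (monomial u 1) = monomial u 1 := by
  rw [shear, aeval_monomial, map_one, one_mul, monomial_eq, C_1, one_mul]
  refine Finsupp.prod_congr fun j hj => ?_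
  rw [hu j hj, C_0, zero_mul, add_zero]

lemma exists_linForm_eq {ι : Type} [Fintype ι] {f : MvPolynomial ι k} (hf : f.IsHomogeneous 1) :
    ∃ c, linForm k c = f := by
  classical
  have h : f ∈ homogeneousSubmodule ι k 1 := hf
  rw [homogeneousSubmodule_one_eq_span_X, Submodule.mem_span_range_iff_exists_fun] at h
  obtain ⟨c, rfl⟩ := h
  exact ⟨c, Finset.sum_congr rfl fun i _ => C_mul'⟩

lemma monIdeal_baseExp_le_comap_shear (D : SC n) (σ : Finset (Fin n)) {w : Fin (n + 1) → k}
    (hw : w (Fin.last n) = 0) (hwσ : ∀ i ∉ σ, w i.castSucc = 0) :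
    monIdeal k (baseExp D σ) ≤ (monIdeal k (baseExp D σ)).comap (shear (Fin.last n) w) := by
  classical
  refine monIdeal_le fun u hu => ?_
  rw [Ideal.mem_comap]
  let u₁ := u.filter fun j => w j = 0
  let u₂ := u.filter fun j => ¬ w j = 0
  have hu₁₂ : u₁ + u₂ = u := Finsupp.filter_add_filter_not u _
  have hx : xSupp u ⊆ xSupp u₁ ∪ σ := by
    intro i hi
    by_cases hiσ : i ∈ σ
    · exact Finset.mem_union_right _ hiσ
    · refine Finset.mem_union_left _ ?_
      rw [mem_xSupp] at hi ⊢
      rwa [Finsupp.filter_apply_pos (fun j => w j = 0) u (hwσ i hiσ)]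
  have hl : u₁ (Fin.last n) = u (Fin.last n) := Finsupp.filter_apply_pos _ _ hw
  have hmul : monomial u (1 : k) = monomial u₁ 1 * monomial u₂ 1 := by
    rw [monomial_mul, hu₁₂, one_mul]
  have hshear : shear (Fin.last n) w (monomial u 1) =
      monomial u₁ 1 * shear (Fin.last n) w (monomial u₂ 1) := by
    rw [hmul, map_mul, shear_monomial]
    intro j hj
    rw [Finsupp.support_filter] at hj
    exact (Finset.mem_filter.1 hj).2
  rcases hu with hu | hu
  · obtain ⟨g, hg⟩ := X_dvd_shear_sub (Fin.last n) w (monomial u₂ 1)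
    rw [sub_eq_iff_eq_add] at hg
    have : shear (Fin.last n) w (monomial u 1) =
        X (Fin.last n) * monomial u₁ 1 * g + monomial u 1 := by
      rw [hshear, hg, hmul]; ring
    rw [this]
    refine Ideal.add_mem _ (Ideal.mul_mem_right _ _ ?_) (monomial_mem_monIdeal (Or.inl hu))
    rw [X, monomial_mul, one_mul]
    refine monomial_mem_monIdeal (Or.inr ⟨?_, fun h => hu ?_⟩)
    · rw [Finsupp.add_apply, Finsupp.single_eq_same]
      omega
    · exact D.down_closed _ h _ (hx.trans (Finset.union_subset_union_left
        (xSupp_mono le_add_self)))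
  · rw [hshear]
    refine Ideal.mul_mem_right _ _ (monomial_mem_monIdeal (Or.inr ⟨?_, fun h => hu.2 ?_⟩))
    · rw [hl]
      exact hu.1
    · exact D.down_closed _ h _ (Finset.union_subset hx Finset.subset_union_right)

/-- The family of ideals `(I, ∏ (T - s xᵢ), T·I_L)`, which degenerates to `I_C` at `s = 0` and is
linearly equivalent to an ideal contained in `J_st` for `s ≠ 0`. -/
def degIdeal (D : SC n) (σ : Finset (Fin n)) (s : k) : Ideal (MvPolynomial (Fin (n + 1)) k) :=
  monIdeal k (baseExp D σ) ⊔ Ideal.span {∏ i ∈ σ, (Tv k n - C s * X i.castSucc)}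

lemma degIdeal_zero {q : ℕ} (D : SC n) (σ : Finset (Fin n)) (hcard : σ.card = q + 1) :
    degIdeal D σ (0 : k) = IC k D σ q := by
  rw [degIdeal, IC_eq_sup]
  simp [hcard]

lemma polyFamily_degIdeal (D : SC n) (σ : Finset (Fin n)) :
    PolyFamily fun x : Unit → k => degIdeal D σ (x ()) := by
  refine (polyFamily_const (isHomI_monIdeal _)).sup
    ⟨Unit, fun _ => ∏ i ∈ σ, (X (Fin.last n) - C (X ()) * X i.castSucc), fun _ => ∑ i ∈ σ, 1,
      fun _ => ?_, fun x => ?_⟩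
  · refine IsHomogeneous.prod _ _ _ fun i _ => (isHomogeneous_X _ _).sub ?_
    simpa using (isHomogeneous_C (Fin (n + 1)) (X () : MvPolynomial Unit k)).mul
      (isHomogeneous_X _ i.castSucc)
  · rw [Set.range_const, map_prod]
    simp [Tv]

/-- For `s ≠ 0` a linear change of coordinates maps `degIdeal D σ s` into `J_st`. -/
lemma exists_shear_degIdeal (D : SC n) (σ : Finset (Fin n)) {s : k} (hs : s ≠ 0) :
    ∃ w : Fin (n + 1) → k, w (Fin.last n) = 0 ∧
      degIdeal D σ s ≤ (Jst k D σ).comap (shear (Fin.last n) w) := by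
  classical
  let w : Fin (n + 1) → k := fun j => if j ∈ σ.map Fin.castSuccEmb then s⁻¹ else 0
  have hwl : w (Fin.last n) = 0 := by
    refine if_neg fun h => ?_
    obtain ⟨i, -, hi⟩ := Finset.mem_map.1 h
    exact (Fin.castSucc_lt_last i).ne hi
  have hwσ : ∀ i ∉ σ, w i.castSucc = 0 := by
    intro i hi
    refine if_neg fun h => hi ?_
    obtain ⟨j, hj, hji⟩ := Finset.mem_map.1 h
    rwa [← Fin.castSucc_injective n hji]
  have hw : ∀ i ∈ σ, w i.castSucc = s⁻¹ := fun i hi => if_pos (Finset.mem_map_of_mem _ hi)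
  refine ⟨w, hwl, sup_le ?_ ?_⟩
  · refine (monIdeal_baseExp_le_comap_shear D σ hwl hwσ).trans (Ideal.comap_mono ?_)
    rw [Jst_eq_sup]
    exact le_sup_left
  · rw [Ideal.span_singleton_le_iff_mem, Ideal.mem_comap, Jst_eq_sup]
    refine Ideal.mem_sup_right ?_
    rw [map_prod, Ideal.mem_span_singleton, xFace, map_prod]
    refine Finset.prod_dvd_prod_of_dvd _ _ fun i hi => ⟨C (-s), ?_⟩
    have hCs : (C s * C s⁻¹ : MvPolynomial (Fin (n + 1)) k) = 1 := by
      rw [← C_mul, mul_inv_cancel₀ hs, C_1]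
    rw [map_sub, map_mul, Tv, shear_X, shear_X, hwl, hw i hi, ← algebraMap_eq, AlgHom.commutes,
      algebraMap_eq, toT, rename_X, C_0, C_neg]
    linear_combination (-X (Fin.last n)) * hCs

lemma redIdeal_le_comap {ι : Type} [Fintype ι] {J K : Ideal (MvPolynomial ι k)} {d : ℕ}
    {ψ : MvPolynomial ι k →ₐ[k] MvPolynomial ι k} (hψ : J ≤ K.comap ψ) {c c' : Fin d × ι → k}
    (hc : ∀ j, linForm k (fun i => c' (j, i)) = ψ (linForm k fun i => c (j, i))) :
    redIdeal k J c ≤ (redIdeal k K c').comap ψ := by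
  refine sup_le (hψ.trans (Ideal.comap_mono le_sup_left)) (Ideal.span_le.2 ?_)
  rintro _ ⟨j, rfl⟩
  change ψ _ ∈ redIdeal k K c'
  rw [← hc]
  exact Ideal.mem_sup_right (Ideal.subset_span ⟨j, rfl⟩)

end Degeneration

section Transfer

variable {k : Type} [Field k] {ι τ : Type} [Fintype ι]

lemma PolyFamily.redIdeal {J : (τ → k) → Ideal (MvPolynomial ι k)} (hJ : PolyFamily J) {d : ℕ}
    (c : Fin d × ι → k) : PolyFamily fun x => redIdeal k (J x) c := by
  simp only [SRWLP.redIdeal]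
  refine hJ.sup (polyFamily_const (isHomI_span _ ?_))
  rintro _ ⟨j, rfl⟩
  exact ⟨1, linForm_isHomogeneous _⟩

/-- Upper semicontinuity along a one-parameter family of ideals with Artinian reduction at `0`. -/
lemma exists_ne_zero_HFq_le [Infinite k] {F : k → Ideal (MvPolynomial ι k)}
    (hF : PolyFamily fun x : Unit → k => F (x ())) {d : ℕ} (c : Fin d × ι → k) (v : ι → k) {N : ℕ}
    (hN : HFq k (redIdeal k (F 0) c) N = 0) :
    ∃ s : k, s ≠ 0 ∧ (∀ m, HFq k (redIdeal k (F s) c) m ≤ HFq k (redIdeal k (F 0) c) m) ∧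
      ∀ m, HFq k (redIdeal k (F s) c ⊔ Ideal.span {linForm k v}) m ≤
        HFq k (redIdeal k (F 0) c ⊔ Ideal.span {linForm k v}) m := by
  have hfam₁ := hF.redIdeal c
  have hfam₂ := hfam₁.sup (polyFamily_const (isHomI_span_singleton (linForm_isHomogeneous v)))
  have hN₂ : HFq k (redIdeal k (F 0) c ⊔ Ideal.span {linForm k v}) N = 0 :=
    Nat.le_zero.1 ((HFq_anti le_sup_left N).trans hN.le)
  obtain ⟨g, hg, hgen⟩ := (hfam₁.openAt_forall_HFq_le (x₀ := fun _ => 0) hN).and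
    (hfam₂.openAt_forall_HFq_le (x₀ := fun _ => 0) hN₂)
  have hg₀ : g ≠ 0 := fun h0 => hg (by rw [h0, map_zero])
  obtain ⟨x, hx⟩ := exists_eval_ne_zero (mul_ne_zero (X_ne_zero (R := k) ()) hg₀)
  rw [map_mul, eval_X] at hx
  exact ⟨x (), left_ne_zero_of_mul hx, hgen x (right_ne_zero_of_mul hx)⟩

/-- An invertible linear substitution mapping `J` into `K` transports reductions of `J` to
reductions of `K` with no larger Hilbert function. -/
lemma exists_reduction_HFq_le {J K : Ideal (MvPolynomial ι k)} {t : ι} {w : ι → k} (hw : w t = 0)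
    (hJK : J ≤ K.comap (shear t w)) {d : ℕ} (c : Fin d × ι → k) (v : ι → k) :
    ∃ (c' : Fin d × ι → k) (v' : ι → k),
      (∀ m, HFq k (redIdeal k K c') m ≤ HFq k (redIdeal k J c) m) ∧
      ∀ m, HFq k (redIdeal k K c' ⊔ Ideal.span {linForm k v'}) m ≤
        HFq k (redIdeal k J c ⊔ Ideal.span {linForm k v}) m := by
  have hlin : ∀ a : ι → k, ∃ b, linForm k b = shear t w (linForm k a) := by
    intro a
    exact exists_linForm_eq (shear_isHomogeneous t w (linForm_isHomogeneous a))
  have hsurj : ∀ (m : ℕ) (f : MvPolynomial ι k), f.IsHomogeneous m →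
      ∃ f', f'.IsHomogeneous m ∧ shear t w f' = f := by
    intro m f hf
    exact ⟨shear t (-w) f, shear_isHomogeneous t (-w) hf, shear_shear_neg hw f⟩
  obtain ⟨c', hc'⟩ : ∃ c' : Fin d → ι → k,
      ∀ j, linForm k (c' j) = shear t w (linForm k fun i => c (j, i)) :=
    Classical.skolem.1 fun j => hlin _
  obtain ⟨v', hv'⟩ := hlin v
  have hred : redIdeal k J c ≤ (redIdeal k K fun p => c' p.1 p.2).comap (shear t w) :=
    redIdeal_le_comap hJK hc'
  have hred' : redIdeal k J c ⊔ Ideal.span {linForm k v} ≤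
      (redIdeal k K (fun p => c' p.1 p.2) ⊔ Ideal.span {linForm k v'}).comap (shear t w) := by
    refine sup_le (hred.trans (Ideal.comap_mono le_sup_left)) ?_
    rw [Ideal.span_singleton_le_iff_mem, Ideal.mem_comap, ← hv']
    exact Ideal.mem_sup_right (Ideal.mem_span_singleton_self _)
  refine ⟨fun p => c' p.1 p.2, v', ?_, ?_⟩
  · intro m
    exact HFq_le_of_map _ hred m (hsurj m)
  · intro m
    exact HFq_le_of_map _ hred' m (hsurj m)

/-- A single good reduction yields Cohen-Macaulayness and the weak Lefschetz property. -/
lemma hasWLP_of_good_reduction {J : Ideal (MvPolynomial ι k)} (hJ : IsHomI J) {d : ℕ}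
    (hdim : ringKrullDim (MvPolynomial ι k ⧸ J) ≤ d) {H : ℕ → ℕ} (hH₀ : H 0 ≠ 0)
    (hle : psum^[d] H ≤ HFq k J) {N : ℕ} (hN : H N = 0) {c : Fin d × ι → k}
    (hc : ∀ m, HFq k (redIdeal k J c) m ≤ H m) {v : ι → k}
    (hv : ∀ m, HFq k (redIdeal k J c ⊔ Ideal.span {linForm k v}) (m + 1) ≤ H (m + 1) - H m) :
    hasWLP k J d := by
  obtain ⟨hHc, hreg⟩ := HFq_redIdeal_eq hJ hle hc
  have hne : redIdeal k J c ≠ ⊤ := ne_top_of_HFq_zero_ne (by rwa [hHc])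
  refine ⟨⟨le_antisymm hdim ?_, (coeffList c).map (linForm k), ?_, ?_, ?_⟩,
    generic_artWLP hJ hle hN c hc v hv⟩
  · have := ringKrullDim_add_length_le hreg
    rw [← redIdeal_eq, List.length_map, length_coeffList] at this
    refine le_trans ?_ this
    have : Nontrivial (MvPolynomial ι k ⧸ redIdeal k J c) := Ideal.Quotient.nontrivial_iff.2 hne
    exact le_add_of_nonneg_left ringKrullDim_nonneg_of_nontrivial
  · rw [List.length_map, length_coeffList]
  · intro f hf
    obtain ⟨a, -, rfl⟩ := List.mem_map.1 hf
    exact linForm_mem_span a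
  · refine isRegular_of_regSeq hreg ?_
    rwa [← redIdeal_eq]

end Transfer

/-- **Lemma.** If `R[T]/I_C` has the WLP then `k[D_σ] = R[T]/J_st` has the WLP. -/
theorem wlp_stellar_of_wlp_IC (k : Type) [Field k] [Infinite k]
    (n q d : ℕ) (hq : 1 ≤ q)
    (D : SC n) (hD : gorStar k D)
    (σ : Finset (Fin n)) (hσ : σ ∈ D.faces) (hcard : σ.card = q + 1)
    (hd : d = dimP D)
    (hW : hasWLP k (IC k D σ q) d) :
    hasWLP k (Jst k D σ) d := by
  obtain ⟨H, N, c, v, hH, hH₀, hN, hc, hv⟩ := exists_good_reduction (isHomI_IC D σ q) hW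
  have hle : psum^[d] H ≤ HFq k (Jst k D σ) := by
    rw [← hH]
    exact HFq_IC_le_HFq_Jst D σ hcard
  obtain ⟨s, hs, h₁, h₂⟩ := exists_ne_zero_HFq_le (polyFamily_degIdeal D σ) c v (N := N) (by
    rw [degIdeal_zero D σ hcard, hc, hN])
  rw [degIdeal_zero D σ hcard] at h₁ h₂
  obtain ⟨w, hw, hwle⟩ := exists_shear_degIdeal D σ hs
  obtain ⟨c', v', hc', hv'⟩ := exists_reduction_HFq_le hw hwle c v
  refine hasWLP_of_good_reduction (isHomI_Jst D σ) ?_ hH₀ hle hN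
    (fun m => (hc' m).trans ((h₁ m).trans (hc m).le))
    fun m => (hv' _).trans ((h₂ _).trans (hv m))
  rw [hd]
  exact ringKrullDim_Jst_le D σ

end SRWLP
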